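/- For every fixed 1 ≤ q < ∞ and every fixed 1 ≤ p ≤ 4, lim_{n→∞} √n · ‖V_{B_qⁿ}‖_p^{1/n} = √(α(1/q)) and lim_{n→∞} √n · ‖U_{B_qⁿ}‖_p^{1/n} = (1/2) √(α(1/q)), where α(t) = e^{1 − 2t} Γ(1 + 3t) / (3 Γ(1 + t)³). -/

import Mathlib

open MeasureTheory Pointwise Filter

/-- The unit ball of `ℓ_qⁿ`: `B_qⁿ = { x ∈ ℝⁿ : Σ |x_i|^q ≤ 1 }`. -/
noncomputable def lqBall (n : ℕ) (q : ℝ) : Set (EuclideanSpace ℝ (Fin n)) :=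
  {x | ∑ i, |x i| ^ q ≤ 1}

/-- The uniform probability measure on a set `K` in `ℝⁿ`. -/
noncomputable def unifMeasure (n : ℕ) (K : Set (EuclideanSpace ℝ (Fin n))) :
    Measure (EuclideanSpace ℝ (Fin n)) :=
  (volume K)⁻¹ • volume.restrict K

/-- The joint distribution of `N` independent uniform random points in `K`. -/
noncomputable def jointUnif (n N : ℕ) (K : Set (EuclideanSpace ℝ (Fin n))) :
    Measure (Fin N → EuclideanSpace ℝ (Fin n)) :=
  Measure.pi fun _ => unifMeasure n K

/-- `U_K`: the normalized volume of the convex hull of `n+1` points. -/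
noncomputable def randSimplexVol (n : ℕ) (K : Set (EuclideanSpace ℝ (Fin n)))
    (x : Fin (n + 1) → EuclideanSpace ℝ (Fin n)) : ℝ :=
  (volume (convexHull ℝ (Set.range x))).toReal / (volume K).toReal

/-- `V_K`: the normalized volume of the symmetric convex hull of `n` points. -/
noncomputable def randCrossVol (n : ℕ) (K : Set (EuclideanSpace ℝ (Fin n)))
    (x : Fin n → EuclideanSpace ℝ (Fin n)) : ℝ :=
  (volume (convexHull ℝ (Set.range x ∪ -Set.range x))).toReal / (volume K).toReal

/-- `‖U_{B_qⁿ}‖_p`. -/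
noncomputable def lpNormUlq (n : ℕ) (q p : ℝ) : ℝ :=
  (∫ x, |randSimplexVol n (lqBall n q) x| ^ p
      ∂(jointUnif n (n + 1) (lqBall n q))) ^ (1 / p)

/-- `‖V_{B_qⁿ}‖_p`. -/
noncomputable def lpNormVlq (n : ℕ) (q p : ℝ) : ℝ :=
  (∫ x, |randCrossVol n (lqBall n q) x| ^ p ∂(jointUnif n n (lqBall n q))) ^ (1 / p)

/-- The function `α(t) = e^{1−2t} Γ(1+3t) / (3 Γ(1+t)³)`. -/
noncomputable def alphaFn (t : ℝ) : ℝ :=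
  Real.exp (1 - 2 * t) * Real.Gamma (1 + 3 * t) / (3 * Real.Gamma (1 + t) ^ 3)

/-- The four ways in which the `j`-th colour forces a quadruple to split into pairs:
colours `0`, `1`, `2` are the three pairings, every other colour forces all entries to agree. -/
def PairedBy {α : Type*} : ℕ → α → α → α → α → Prop
  | 0, a, b, c, d => a = b ∧ c = d
  | 1, a, b, c, d => a = c ∧ b = d
  | 2, a, b, c, d => a = d ∧ b = c
  | _ + 3, a, b, c, d => a = b ∧ a = c ∧ a = d

instance {α : Type*} [DecidableEq α] (j : ℕ) (a b c d : α) : Decidable (PairedBy j a b c d) := by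
  rcases j with _ | _ | _ | j <;> unfold PairedBy <;> infer_instance

section Counting

open Equiv Finset

variable {ι : Type*} {γ : ι → ℕ} {σ₁ σ₂ σ₃ σ₄ : Perm ι}

/-- The permutation moving each row to the row from which its second pair is taken. -/
def pairingFun (γ : ι → ℕ) (σ₁ σ₂ σ₃ : Perm ι) (i : ι) : ι :=
  match γ i with
  | 0 => σ₁.symm (σ₃ i)
  | 1 => σ₁.symm (σ₂ i)
  | 2 => σ₁.symm (σ₂ i)
  | _ + 3 => i

theorem color_pairingFun (h : ∀ i, PairedBy (γ i) (σ₁ i) (σ₂ i) (σ₃ i) (σ₄ i)) (i : ι) :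
    γ (pairingFun γ σ₁ σ₂ σ₃ i) = γ i := by
  by_contra hne
  have hi := h i
  set j := pairingFun γ σ₁ σ₂ σ₃ i with hj
  have hj' := h j
  have hij : j ≠ i := fun e => hne (by rw [e])
  have key : σ₁ j = σ₂ i ∨ σ₁ j = σ₃ i := by
    rw [hj]; unfold pairingFun
    rcases hγ : γ i with _ | _ | _ | k
    · simp
    · simp
    · simp
    · exact absurd (by rw [hj]; simp [pairingFun, hγ]) hij
  have h1 := σ₁.injective.ne hij
  have h2 := σ₂.injective.ne hij
  have h3 := σ₃.injective.ne hij
  have h4 := σ₄.injective.ne hij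
  have hs : σ₁ j = match γ i with
    | 0 => σ₃ i
    | 1 => σ₂ i
    | 2 => σ₂ i
    | _ + 3 => σ₁ i := by
    rw [hj]; unfold pairingFun
    rcases γ i with _ | _ | _ | k <;> simp
  rcases hγ : γ i with _ | _ | _ | k <;> rcases hγ' : γ j with _ | _ | _ | k' <;>
    simp only [hγ, hγ', PairedBy] at hi hj' hs hne <;> grind

theorem pairingFun_injective (h : ∀ i, PairedBy (γ i) (σ₁ i) (σ₂ i) (σ₃ i) (σ₄ i)) :
    Function.Injective (pairingFun γ σ₁ σ₂ σ₃) := by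
  intro i j hij
  have hc : γ i = γ j := by
    rw [← color_pairingFun h i, ← color_pairingFun h j, hij]
  unfold pairingFun at hij
  rw [hc] at hij
  rcases hγ : γ j with _ | _ | _ | k <;> simpa [hγ] using hij

theorem card_pairedBy_le {c N : ℕ} (κ : Fin N → Fin c) :
    #{σ : Perm (Fin N) × Perm (Fin N) × Perm (Fin N) × Perm (Fin N) |
        ∀ i, PairedBy (κ i) (σ.1 i) (σ.2.1 i) (σ.2.2.1 i) (σ.2.2.2 i)} ≤
      N.factorial * ∏ j, (Fintype.card {i // κ i = j}).factorial := by
  have hN : N.factorial = Fintype.card (Perm (Fin N)) := by simp [Fintype.card_perm]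
  rw [← DomMulAct.stabilizer_card, hN, ← Fintype.card_prod, ← Fintype.card_subtype]
  have hinj : ∀ σ : {σ : Perm (Fin N) × Perm (Fin N) × Perm (Fin N) × Perm (Fin N) //
      ∀ i, PairedBy (κ i) (σ.1 i) (σ.2.1 i) (σ.2.2.1 i) (σ.2.2.2 i)},
      Function.Bijective (pairingFun (fun i => (κ i : ℕ)) σ.1.1 σ.1.2.1 σ.1.2.2.1) :=
    fun σ => Finite.injective_iff_bijective.1 (pairingFun_injective σ.2)
  refine Fintype.card_le_of_injective
    (fun σ => (σ.1.1, ⟨Equiv.ofBijective _ (hinj σ), ?_⟩)) ?_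
  · ext i
    exact color_pairingFun σ.2 i
  · rintro ⟨⟨s₁, s₂, s₃, s₄⟩, hs⟩ ⟨⟨t₁, t₂, t₃, t₄⟩, ht⟩ hst
    simp only [Prod.mk.injEq, Subtype.mk.injEq] at hst
    obtain ⟨rfl, h⟩ := hst
    have hfun : ∀ i, pairingFun (fun i => (κ i : ℕ)) s₁ s₂ s₃ i
        = pairingFun (fun i => (κ i : ℕ)) s₁ t₂ t₃ i := fun i => by
      simpa using congrArg (fun e : Perm (Fin N) => e i) h
    have hall : ∀ i, s₂ i = t₂ i ∧ s₃ i = t₃ i ∧ s₄ i = t₄ i := fun i => by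
      have h1 := hs i
      have h2 := ht i
      have h3 := hfun i
      unfold pairingFun at h3
      rcases hγ : (κ i : ℕ) with _ | _ | _ | k <;>
        simp only [hγ, PairedBy, EmbeddingLike.apply_eq_iff_eq] at h1 h2 h3 <;> grind
    simp only [Subtype.mk.injEq, Prod.mk.injEq, true_and]
    exact ⟨Equiv.ext fun i => (hall i).1, Equiv.ext fun i => (hall i).2.1,
      Equiv.ext fun i => (hall i).2.2⟩

theorem sum_prod_factorial_card_fiber (c N : ℕ) :
    ∑ κ : Fin N → Fin c, ∏ j, (Fintype.card {i // κ i = j}).factorial = c.ascFactorial N := by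
  induction N with
  | zero => simp
  | succ N ih =>
    rw [← (Fin.consEquiv fun _ => Fin c).sum_comp, Fintype.sum_prod_type, sum_comm,
      Nat.ascFactorial_succ, ← ih, mul_sum]
    refine sum_congr rfl fun κ _ => ?_
    have hcard : ∀ a j, Fintype.card {i // (Fin.cons a κ : Fin (N + 1) → Fin c) i = j}
        = Fintype.card {i // κ i = j} + if a = j then 1 else 0 := fun a j => by
      simp only [Fintype.card_subtype, Fin.card_filter_univ_succ, Fin.cons_zero, Fin.cons_succ]
      split_ifs <;> simp
    have hprod : ∀ a, ∏ j, (Fintype.card {i // (Fin.cons a κ : Fin (N + 1) → Fin c) i = j}).factorial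
        = (Fintype.card {i // κ i = a} + 1) * ∏ j, (Fintype.card {i // κ i = j}).factorial := by
      intro a
      rw [← mul_prod_erase univ _ (mem_univ a),
        ← mul_prod_erase univ (fun j => (Fintype.card {i // κ i = j}).factorial) (mem_univ a),
        hcard, if_pos rfl, Nat.factorial_succ, mul_assoc]
      congr 2
      refine prod_congr rfl fun j hj => ?_
      rw [hcard, if_neg (ne_of_mem_erase hj).symm, add_zero]
    refine (sum_congr rfl fun a _ => hprod a).trans ?_
    rw [← sum_mul]
    congr 1
    rw [sum_add_distrib]
    have : ∑ a, Fintype.card {i // κ i = a} = N := by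
      simp only [Fintype.card_subtype]
      rw [← card_eq_sum_card_fiberwise (fun _ _ => mem_univ _)]
      simp
    rw [this]
    simp [add_comm]

theorem sum_card_pairedBy_le (c N : ℕ) :
    ∑ κ : Fin N → Fin c, #{σ : Perm (Fin N) × Perm (Fin N) × Perm (Fin N) × Perm (Fin N) |
        ∀ i, PairedBy (κ i) (σ.1 i) (σ.2.1 i) (σ.2.2.1 i) (σ.2.2.2 i)} ≤
      N.factorial * c.ascFactorial N := by
  rw [← sum_prod_factorial_card_fiber, mul_sum]
  refine sum_le_sum fun κ _ => ?_
  exact card_pairedBy_le κ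

end Counting

section DeterminantMoments

open Equiv Finset

variable {Ω : Type*} [MeasurableSpace Ω] {ν : Measure Ω} [IsProbabilityMeasure ν] {N : ℕ}
  {Y : Fin N → Ω → ℝ} {s : ℝ}

theorem det_sq_eq_sum (M : Matrix (Fin N) (Fin N) ℝ) :
    M.det ^ 2 = ∑ σ : Perm (Fin N) × Perm (Fin N),
      ((σ.1.sign : ℤ) * (σ.2.sign : ℤ) : ℝ) * ∏ i, (M (σ.1 i) i * M (σ.2 i) i) := by
  rw [sq, Matrix.det_apply', sum_mul_sum, Fintype.sum_prod_type]
  simp only [prod_mul_distrib]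
  exact sum_congr rfl fun _ _ => sum_congr rfl fun _ _ => by ring

theorem det_pow_four_eq_sum (M : Matrix (Fin N) (Fin N) ℝ) :
    M.det ^ 4 = ∑ σ : Perm (Fin N) × Perm (Fin N) × Perm (Fin N) × Perm (Fin N),
      ((σ.1.sign : ℤ) * (σ.2.1.sign : ℤ) * (σ.2.2.1.sign : ℤ) * (σ.2.2.2.sign : ℤ) : ℝ) *
        ∏ i, (M (σ.1 i) i * M (σ.2.1 i) i * M (σ.2.2.1 i) i * M (σ.2.2.2 i) i) := by
  have : M.det ^ 4 = M.det * (M.det * (M.det * M.det)) := by ring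
  rw [this, Matrix.det_apply']
  simp only [Fintype.sum_prod_type, mul_sum, sum_mul, prod_mul_distrib]
  refine sum_congr rfl fun a _ => sum_congr rfl fun b _ => sum_congr rfl fun c _ =>
    sum_congr rfl fun d _ => by ring

theorem integral_det_sq (hInt : ∀ a b, Integrable (fun x => Y a x * Y b x) ν)
    (hcov : ∀ a b, ∫ x, Y a x * Y b x ∂ν = if a = b then s else 0) :
    ∫ x : Fin N → Ω, (Matrix.of fun b i => Y b (x i)).det ^ 2 ∂(Measure.pi fun _ => ν) =
      N.factorial * s ^ N := by
  simp only [det_sq_eq_sum, Matrix.of_apply]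
  rw [integral_finsetSum _ fun σ _ => (Integrable.fintype_prod
    (f := fun i x => Y (σ.1 i) x * Y (σ.2 i) x) fun i => hInt _ _).const_mul _]
  simp only [integral_const_mul]
  have h : ∀ σ : Perm (Fin N) × Perm (Fin N),
      ∫ x : Fin N → Ω, ∏ i, (Y (σ.1 i) (x i) * Y (σ.2 i) (x i)) ∂(Measure.pi fun _ => ν) =
        if σ.1 = σ.2 then s ^ N else 0 := fun σ => by
    rw [integral_fintype_prod_eq_prod (fun i x => Y (σ.1 i) x * Y (σ.2 i) x)]
    simp only [hcov]
    split_ifs with hσ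
    · simp [hσ]
    · obtain ⟨i, hi⟩ := not_forall.1 fun h' => hσ (Equiv.ext h')
      exact prod_eq_zero (mem_univ i) (if_neg hi)
  simp only [h, mul_ite, mul_zero, Fintype.sum_prod_type, sum_ite_eq, mem_univ, if_true]
  have hs : ∀ σ : Perm (Fin N), ((σ.sign : ℤ) : ℝ) * ((σ.sign : ℤ) : ℝ) = 1 := fun σ => by
    rcases Int.units_eq_one_or σ.sign with h | h <;> simp [h]
  simp [hs, Fintype.card_perm]

theorem integrable_det_pow_four
    (hInt : ∀ a b c d, Integrable (fun x => Y a x * Y b x * Y c x * Y d x) ν) :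
    Integrable (fun x : Fin N → Ω => (Matrix.of fun b i => Y b (x i)).det ^ 4)
      (Measure.pi fun _ => ν) := by
  simp only [det_pow_four_eq_sum, Matrix.of_apply]
  exact integrable_finsetSum _ fun σ _ => (Integrable.fintype_prod
    (f := fun i x => Y (σ.1 i) x * Y (σ.2.1 i) x * Y (σ.2.2.1 i) x * Y (σ.2.2.2 i) x)
    fun i => hInt _ _ _ _).const_mul _

theorem integral_det_pow_four_le {c : ℕ}
    (hInt : ∀ a b c d, Integrable (fun x => Y a x * Y b x * Y c x * Y d x) ν)
    (hmom : ∀ a₁ a₂ a₃ a₄, |∫ x, Y a₁ x * Y a₂ x * Y a₃ x * Y a₄ x ∂ν| ≤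
      s ^ 2 * ∑ j : Fin c, if PairedBy j a₁ a₂ a₃ a₄ then 1 else 0) :
    ∫ x : Fin N → Ω, (Matrix.of fun b i => Y b (x i)).det ^ 4 ∂(Measure.pi fun _ => ν) ≤
      N.factorial * c.ascFactorial N * s ^ (2 * N) := by
  simp only [det_pow_four_eq_sum, Matrix.of_apply]
  rw [integral_finsetSum _ fun σ _ => (Integrable.fintype_prod
    (f := fun i x => Y (σ.1 i) x * Y (σ.2.1 i) x * Y (σ.2.2.1 i) x * Y (σ.2.2.2 i) x)
    fun i => hInt _ _ _ _).const_mul _]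
  simp only [integral_const_mul]
  have hsign : ∀ σ : Perm (Fin N), |((σ.sign : ℤ) : ℝ)| = 1 := fun σ => by
    rcases Int.units_eq_one_or σ.sign with h | h <;> simp [h]
  calc _ ≤ ∑ σ : Perm (Fin N) × Perm (Fin N) × Perm (Fin N) × Perm (Fin N),
        s ^ (2 * N) * ∑ κ : Fin N → Fin c,
          if ∀ i, PairedBy (κ i) (σ.1 i) (σ.2.1 i) (σ.2.2.1 i) (σ.2.2.2 i) then (1 : ℝ) else 0 := by
        refine sum_le_sum fun σ _ => (le_abs_self _).trans ?_
        rw [integral_fintype_prod_eq_prod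
          (fun i x => Y (σ.1 i) x * Y (σ.2.1 i) x * Y (σ.2.2.1 i) x * Y (σ.2.2.2 i) x),
          abs_mul, abs_prod]
        simp only [abs_mul, hsign, one_mul]
        refine (prod_le_prod (fun _ _ => abs_nonneg _) fun i _ => hmom _ _ _ _).trans ?_
        rw [prod_mul_distrib, prod_const, card_univ, Fintype.card_fin, ← pow_mul, prod_univ_sum]
        simp only [prod_boole, mem_univ, true_imp_iff, Fintype.piFinset_univ]
        exact le_rfl
    _ = s ^ (2 * N) * ((∑ κ : Fin N → Fin c,
          #{σ : Perm (Fin N) × Perm (Fin N) × Perm (Fin N) × Perm (Fin N) |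
            ∀ i, PairedBy (κ i) (σ.1 i) (σ.2.1 i) (σ.2.2.1 i) (σ.2.2.2 i)} : ℕ) : ℝ) := by
        rw [← mul_sum, sum_comm]
        push_cast
        simp only [sum_boole]
    _ ≤ s ^ (2 * N) * ((N.factorial * c.ascFactorial N : ℕ) : ℝ) := by
        have : 0 ≤ s ^ (2 * N) := by rw [pow_mul]; positivity
        gcongr
        exact sum_card_pairedBy_le c N
    _ = _ := by push_cast; ring

end DeterminantMoments

section DirichletIntegrals

open Finset

theorem lintegral_exp_neg_indicator {u : ℝ} (hu : 0 ≤ u) :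
    ∫⁻ t in Set.Ioi (0 : ℝ), (if u ≤ t then ENNReal.ofReal (Real.exp (-t)) else 0) =
      ENNReal.ofReal (Real.exp (-u)) := by
  have h1 : ∀ t : ℝ, (if u ≤ t then ENNReal.ofReal (Real.exp (-t)) else 0) =
      (Set.Ici u).indicator (fun t => ENNReal.ofReal (Real.exp (-t))) t := fun t => by
    simp [Set.indicator]
  simp only [h1]
  rw [lintegral_indicator measurableSet_Ici, Measure.restrict_restrict measurableSet_Ici]
  have h2 : (Set.Ici u ∩ Set.Ioi 0 : Set ℝ) =ᵐ[volume] Set.Ioi u := by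
    rcases hu.eq_or_lt with rfl | hu
    · exact (Set.inter_eq_self_of_subset_right Set.Ioi_subset_Ici_self).eventuallyEq
    · rw [Set.inter_eq_self_of_subset_left (Set.Ici_subset_Ioi.2 hu)]
      exact Ioi_ae_eq_Ici.symm
  rw [Measure.restrict_congr_set h2, ← integral_exp_neg_Ioi u,
    ofReal_integral_eq_lintegral_ofReal (integrableOn_exp_neg_Ioi u)
      (ae_of_all _ fun t => (Real.exp_pos _).le)]

variable {n : ℕ} {q : ℝ} {h : Fin n → ℝ → ℝ} {s : Fin n → ℕ}

theorem lintegral_sublevel_scaling (hq : 0 < q) (hmeas : ∀ i, Measurable (h i))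
    (hhom : ∀ i r u, 0 < r → h i (r * u) = r ^ s i * h i u) {t : ℝ} (ht : 0 < t) :
    ∫⁻ x : Fin n → ℝ, (if ∑ i, |x i| ^ q ≤ t then ENNReal.ofReal (∏ i, h i (x i)) else 0) =
      ENNReal.ofReal (t ^ ((n + ∑ i, s i : ℝ) / q)) *
        ∫⁻ x : Fin n → ℝ, (if ∑ i, |x i| ^ q ≤ 1 then ENNReal.ofReal (∏ i, h i (x i)) else 0) := by
  set r : ℝ := t ^ (1 / q) with hr
  have hr0 : 0 < r := Real.rpow_pos_of_pos ht _
  have hrq : r ^ q = t := by rw [hr, ← Real.rpow_mul ht.le, one_div_mul_cancel hq.ne', Real.rpow_one]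
  set F : (Fin n → ℝ) → ENNReal :=
    fun x => if ∑ i, |x i| ^ q ≤ t then ENNReal.ofReal (∏ i, h i (x i)) else 0 with hF
  have hFm : Measurable F := by
    refine Measurable.ite (measurableSet_le (by fun_prop) measurable_const) ?_ measurable_const
    exact ENNReal.measurable_ofReal.comp
      (Finset.measurable_prod _ fun i _ => (hmeas i).comp (measurable_pi_apply i))
  have hmap := Measure.map_addHaar_smul (volume : Measure (Fin n → ℝ)) hr0.ne'
  have hcomp : ∫⁻ x, F (r • x) = ENNReal.ofReal (r ^ n)⁻¹ * ∫⁻ x, F x := by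
    rw [← lintegral_map hFm (measurable_const_smul r), hmap, lintegral_smul_measure]
    simp only [Module.finrank_fin_fun, smul_eq_mul]
    rw [abs_of_pos (by positivity)]
  have hFr : ∀ x, F (r • x) = ENNReal.ofReal (r ^ ∑ i, s i) *
      (if ∑ i, |x i| ^ q ≤ 1 then ENNReal.ofReal (∏ i, h i (x i)) else 0) := fun x => by
    have h1 : ∑ i, |r * x i| ^ q = t * ∑ i, |x i| ^ q := by
      rw [mul_sum]
      refine sum_congr rfl fun i _ => ?_
      rw [abs_mul, abs_of_pos hr0, Real.mul_rpow hr0.le (abs_nonneg _), hrq]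
    have h2 : (t * ∑ i, |x i| ^ q ≤ t) ↔ ∑ i, |x i| ^ q ≤ 1 := by
      rw [mul_le_iff_le_one_right ht]
    simp only [hF, Pi.smul_apply, smul_eq_mul, h1, h2, hhom _ _ _ hr0, prod_mul_distrib,
      prod_pow_eq_pow_sum]
    split_ifs
    · rw [ENNReal.ofReal_mul (by positivity)]
    · simp
  have hpow : t ^ ((n + ∑ i, s i : ℝ) / q) = r ^ n * r ^ ∑ i, s i := by
    rw [← pow_add, hr, ← Real.rpow_natCast, ← Real.rpow_mul ht.le]
    congr 1
    push_cast
    ring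
  have hI : ∫⁻ x, F x = ENNReal.ofReal (r ^ n) * ∫⁻ x, F (r • x) := by
    rw [hcomp, ← mul_assoc, ← ENNReal.ofReal_mul (by positivity),
      mul_inv_cancel₀ (by positivity), ENNReal.ofReal_one, one_mul]
  rw [hI, hpow, ENNReal.ofReal_mul (by positivity), mul_assoc]
  congr 1
  simp only [hFr]
  rw [lintegral_const_mul' _ _ ENNReal.ofReal_ne_top]

/-- Dirichlet's formula for homogeneous product densities on the unit ball of `ℓ_q`. -/
theorem lintegral_prod_homogeneous (hq : 0 < q) (hmeas : ∀ i, Measurable (h i))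
    (hnn : ∀ i u, 0 ≤ h i u)
    (hhom : ∀ i r u, 0 < r → h i (r * u) = r ^ s i * h i u)
    (hInt : ∀ i, Integrable fun u => h i u * Real.exp (-|u| ^ q)) :
    ∫⁻ x in {x : Fin n → ℝ | ∑ i, |x i| ^ q ≤ 1}, ENNReal.ofReal (∏ i, h i (x i)) =
      ENNReal.ofReal ((∏ i, ∫ u, h i u * Real.exp (-|u| ^ q)) /
        Real.Gamma ((n + ∑ i, s i : ℝ) / q + 1)) := by
  set J := ∫⁻ x : Fin n → ℝ,
    (if ∑ i, |x i| ^ q ≤ 1 then ENNReal.ofReal (∏ i, h i (x i)) else 0) with hJ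
  set e : ℝ := (n + ∑ i, s i : ℝ) / q with he
  have he0 : 0 ≤ e := by positivity
  have hΓ : 0 < Real.Gamma (e + 1) := Real.Gamma_pos_of_pos (by positivity)
  have hHm : Measurable fun x : Fin n → ℝ => ENNReal.ofReal (∏ i, h i (x i)) :=
    ENNReal.measurable_ofReal.comp
      (Finset.measurable_prod _ fun i _ => (hmeas i).comp (measurable_pi_apply i))
  have hgm : Measurable fun x : Fin n → ℝ => ∑ i, |x i| ^ q := by fun_prop
  have hleft : ∫⁻ x in {x : Fin n → ℝ | ∑ i, |x i| ^ q ≤ 1}, ENNReal.ofReal (∏ i, h i (x i)) = J := by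
    rw [← lintegral_indicator (measurableSet_le hgm measurable_const)]
    simp only [Set.indicator, Set.mem_ofPred_eq, hJ]
  have hprod : ∀ x : Fin n → ℝ, ENNReal.ofReal (∏ i, (h i (x i) * Real.exp (-|x i| ^ q))) =
      ∫⁻ t in Set.Ioi (0 : ℝ), ENNReal.ofReal (Real.exp (-t)) *
        (if ∑ i, |x i| ^ q ≤ t then ENNReal.ofReal (∏ i, h i (x i)) else 0) := fun x => by
    rw [prod_mul_distrib, ENNReal.ofReal_mul (prod_nonneg fun i _ => hnn i _), ← Real.exp_sum,
      sum_neg_distrib, ← lintegral_exp_neg_indicator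
        (sum_nonneg fun i _ => Real.rpow_nonneg (abs_nonneg _) _),
      ← lintegral_const_mul' _ _ ENNReal.ofReal_ne_top]
    refine lintegral_congr fun t => ?_
    split_ifs <;> simp [mul_comm]
  have hIntp : Integrable fun x : Fin n → ℝ => ∏ i, (h i (x i) * Real.exp (-|x i| ^ q)) :=
    Integrable.fintype_prod (f := fun i u => h i u * Real.exp (-|u| ^ q)) hInt
  have hmain : ENNReal.ofReal (∏ i, ∫ u, h i u * Real.exp (-|u| ^ q)) =
      ENNReal.ofReal (Real.Gamma (e + 1)) * J := by
    rw [← integral_fintype_prod_volume_eq_prod (fun i u => h i u * Real.exp (-|u| ^ q)),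
      ofReal_integral_eq_lintegral_ofReal
        hIntp
        (ae_of_all _ fun x => prod_nonneg fun i _ => mul_nonneg (hnn i _) (Real.exp_pos _).le)]
    simp only [hprod]
    rw [lintegral_lintegral_swap]
    · have : ∀ t ∈ Set.Ioi (0 : ℝ), ∫⁻ x : Fin n → ℝ, ENNReal.ofReal (Real.exp (-t)) *
          (if ∑ i, |x i| ^ q ≤ t then ENNReal.ofReal (∏ i, h i (x i)) else 0) =
          ENNReal.ofReal (Real.exp (-t) * t ^ (e + 1 - 1)) * J := fun t ht => by
        rw [lintegral_const_mul' _ _ ENNReal.ofReal_ne_top,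
          lintegral_sublevel_scaling hq hmeas hhom ht, ← mul_assoc,
          ← ENNReal.ofReal_mul (Real.exp_pos _).le, add_sub_cancel_right]
      rw [setLIntegral_congr_fun measurableSet_Ioi this,
        lintegral_mul_const _ (by fun_prop), Real.Gamma_eq_integral (by positivity),
        ofReal_integral_eq_lintegral_ofReal (Real.GammaIntegral_convergent (by positivity))]
      refine (ae_restrict_iff' measurableSet_Ioi).2 (ae_of_all _ fun t ht => ?_)
      exact mul_nonneg (Real.exp_pos _).le (Real.rpow_nonneg (le_of_lt ht) _)
    · refine Measurable.aemeasurable ?_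
      refine Measurable.mul (by fun_prop) (Measurable.ite ?_ (hHm.comp measurable_fst)
        measurable_const)
      exact measurableSet_le (hgm.comp measurable_fst) measurable_snd
  rw [hleft, ENNReal.ofReal_div_of_pos hΓ, hmain, mul_comm, ENNReal.mul_div_cancel_right]
  · simpa using hΓ
  · simp

theorem integral_pow_mul_exp_neg_abs_rpow (hq : 0 < q) (k : ℕ) :
    ∫ u : ℝ, |u| ^ k * Real.exp (-|u| ^ q) = 2 / q * Real.Gamma ((k + 1) / q) := by
  rw [integral_comp_abs (f := fun u => u ^ k * Real.exp (-u ^ q))]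
  have := integral_rpow_mul_exp_neg_rpow (q := k) hq
    ((neg_lt_zero.2 one_pos).trans_le (Nat.cast_nonneg k))
  simp only [Real.rpow_natCast] at this
  rw [this]
  ring

theorem integrable_pow_mul_exp_neg_abs_rpow (hq : 0 < q) (k : ℕ) :
    Integrable fun u : ℝ => |u| ^ k * Real.exp (-|u| ^ q) := by
  refine not_imp_comm.1 integral_undef (ne_of_gt ?_)
  rw [integral_pow_mul_exp_neg_abs_rpow hq]
  have : 0 < Real.Gamma ((k + 1) / q) := Real.Gamma_pos_of_pos (by positivity)
  positivity

theorem lintegral_prod_abs_pow (hq : 0 < q) (s : Fin n → ℕ) :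
    ∫⁻ x in {x : Fin n → ℝ | ∑ i, |x i| ^ q ≤ 1}, ENNReal.ofReal (∏ i, |x i| ^ s i) =
      ENNReal.ofReal ((∏ i, (2 / q * Real.Gamma ((s i + 1) / q))) /
        Real.Gamma ((n + ∑ i, s i : ℝ) / q + 1)) := by
  have := lintegral_prod_homogeneous (h := fun i u => |u| ^ s i) (s := s) hq
    (fun i => by fun_prop) (fun i u => by positivity)
    (fun i r u hr => by rw [abs_mul, mul_pow, abs_of_pos hr])
    (fun i => integrable_pow_mul_exp_neg_abs_rpow hq _)
  simpa only [integral_pow_mul_exp_neg_abs_rpow hq] using this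

theorem volume_l1Ball (n : ℕ) :
    volume {x : Fin n → ℝ | ∑ i, |x i| ≤ 1} = ENNReal.ofReal (2 ^ n / n.factorial) := by
  have := lintegral_prod_abs_pow (n := n) one_pos 0
  simpa [Real.Gamma_nat_eq_factorial, Real.Gamma_one] using this

theorem integral_indicator_exp_neg_abs :
    ∫ u : ℝ, (if 0 ≤ u then 1 else 0) * Real.exp (-|u| ^ (1 : ℝ)) = 1 := by
  have h : ∀ u : ℝ, (if 0 ≤ u then 1 else 0) * Real.exp (-|u| ^ (1 : ℝ)) =
      (Set.Ici 0).indicator (fun u => Real.exp (-u)) u := fun u => by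
    by_cases hu : 0 ≤ u <;> simp [Set.indicator, hu, abs_of_nonneg]
  simp only [h]
  rw [integral_indicator measurableSet_Ici, integral_Ici_eq_integral_Ioi, integral_exp_neg_Ioi]
  simp

theorem volume_cornerSimplex (n : ℕ) :
    volume {x : Fin n → ℝ | (∀ i, 0 ≤ x i) ∧ ∑ i, x i ≤ 1} =
      ENNReal.ofReal (1 / n.factorial) := by
  have := lintegral_prod_homogeneous (n := n) (h := fun _ u => if 0 ≤ u then 1 else 0)
    (s := 0) one_pos
    (fun i => Measurable.ite measurableSet_Ici measurable_const measurable_const)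
    (fun i u => by split_ifs <;> simp)
    (fun i r u hr => by simp [mul_nonneg_iff_of_pos_left hr])
    (fun i => not_imp_comm.1 integral_undef (by rw [integral_indicator_exp_neg_abs]; simp))
  simp only [integral_indicator_exp_neg_abs] at this
  simp only [prod_const_one, Pi.zero_apply, sum_const_zero, Nat.cast_zero, add_zero, div_one,
    Real.Gamma_nat_eq_factorial, Real.rpow_one, prod_boole, mem_univ, true_imp_iff] at this
  rw [← this]
  have hm : MeasurableSet {x : Fin n → ℝ | ∀ i, 0 ≤ x i} := by
    simp only [Set.ofPred_forall]
    exact MeasurableSet.iInter fun i => measurableSet_le measurable_const (measurable_pi_apply i)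
  have hind : ∀ x : Fin n → ℝ, ENNReal.ofReal (if ∀ i, 0 ≤ x i then 1 else 0) =
      {x : Fin n → ℝ | ∀ i, 0 ≤ x i}.indicator 1 x := fun x => by
    by_cases hx : ∀ i, 0 ≤ x i <;> simp [Set.indicator, hx]
  simp only [hind]
  rw [lintegral_indicator_one hm, Measure.restrict_apply hm]
  congr 1
  ext x
  simp only [Set.mem_inter_iff, Set.mem_ofPred_eq]
  refine and_congr_right fun hx => ?_
  rw [sum_congr rfl fun i _ => abs_of_nonneg (hx i)]

end DirichletIntegrals

section HullVolumes

open Finset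

theorem Convex.sum_mem_of_sum_le_one {E : Type*} [AddCommGroup E] [Module ℝ E] {n : ℕ} {S : Set E}
    (hS : Convex ℝ S) {z₀ : E} (h0 : z₀ ∈ S) {w : Fin n → ℝ} {z : Fin n → E}
    (hw : ∀ i, 0 ≤ w i) (hsum : ∑ i, w i ≤ 1) (hz : ∀ i, z i ∈ S) :
    (1 - ∑ i, w i) • z₀ + ∑ i, w i • z i ∈ S := by
  have := hS.sum_mem (t := univ) (w := Fin.cons (1 - ∑ i, w i) w) (z := Fin.cons z₀ z)
    (fun i _ => by refine Fin.cases ?_ (fun i => ?_) i <;> simp [hw, hsum])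
    (by simp [Fin.sum_univ_succ])
    (fun i _ => by refine Fin.cases ?_ (fun i => ?_) i <;> simp [h0, hz])
  simpa [Fin.sum_univ_succ] using this

variable {n : ℕ}

theorem volume_image_sum_smul (x : Fin n → EuclideanSpace ℝ (Fin n)) (S : Set (Fin n → ℝ)) :
    volume ((fun w : Fin n → ℝ => ∑ i, w i • x i) '' S) =
      ENNReal.ofReal |(Matrix.of fun b i => x i b).det| * volume S := by
  have h : (fun w : Fin n → ℝ => ∑ i, w i • x i) '' S =
      (MeasurableEquiv.toLp 2 (Fin n → ℝ)).symm ⁻¹'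
        (Matrix.toLin' (Matrix.of fun b i => x i b) '' S) := by
    rw [← MeasurableEquiv.image_eq_preimage_symm, Set.image_image]
    refine Set.image_congr fun w _ => ?_
    ext b
    simp [Matrix.mulVec, dotProduct, mul_comm]
  rw [h, (EuclideanSpace.volume_preserving_symm_measurableEquiv_toLp (Fin n)).measure_preimage_equiv,
    Measure.addHaar_image_linearMap, LinearMap.det_toLin']

theorem convex_l1Ball (n : ℕ) : Convex ℝ {w : Fin n → ℝ | ∑ i, |w i| ≤ 1} := by
  intro u hu v hv a b ha hb hab
  simp only [Set.mem_ofPred_eq, Pi.add_apply, Pi.smul_apply, smul_eq_mul] at *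
  calc ∑ i, |a * u i + b * v i| ≤ ∑ i, (a * |u i| + b * |v i|) := by
        refine sum_le_sum fun i _ => (abs_add_le _ _).trans_eq ?_
        rw [abs_mul, abs_mul, abs_of_nonneg ha, abs_of_nonneg hb]
    _ = a * ∑ i, |u i| + b * ∑ i, |v i| := by rw [sum_add_distrib, mul_sum, mul_sum]
    _ ≤ a * 1 + b * 1 := by gcongr
    _ = 1 := by linarith

theorem convex_cornerSimplex (n : ℕ) :
    Convex ℝ {w : Fin n → ℝ | (∀ i, 0 ≤ w i) ∧ ∑ i, w i ≤ 1} := by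
  intro u hu v hv a b ha hb hab
  simp only [Set.mem_ofPred_eq, Pi.add_apply, Pi.smul_apply, smul_eq_mul] at *
  refine ⟨fun i => add_nonneg (mul_nonneg ha (hu.1 i)) (mul_nonneg hb (hv.1 i)), ?_⟩
  rw [sum_add_distrib, ← mul_sum, ← mul_sum]
  nlinarith [hu.2, hv.2]

theorem isLinearMap_sum_smul {ι : Type*} [Fintype ι] {E : Type*} [AddCommGroup E] [Module ℝ E]
    (x : ι → E) : IsLinearMap ℝ fun w : ι → ℝ => ∑ i, w i • x i :=
  ⟨fun u v => by simp [add_smul, sum_add_distrib], fun c u => by simp [mul_smul, smul_sum]⟩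

theorem convexHull_range_union_neg (hn : n ≠ 0) (x : Fin n → EuclideanSpace ℝ (Fin n)) :
    convexHull ℝ (Set.range x ∪ -Set.range x) =
      (fun w : Fin n → ℝ => ∑ i, w i • x i) '' {w | ∑ i, |w i| ≤ 1} := by
  apply Set.Subset.antisymm
  · refine convexHull_min ?_ ((convex_l1Ball n).is_linear_image (isLinearMap_sum_smul x))
    rintro _ (⟨i, rfl⟩ | ⟨i, hi⟩)
    · exact ⟨Pi.single i 1, by simp [Pi.single_apply, apply_ite abs], by simp [Pi.single_apply]⟩
    · refine ⟨Pi.single i (-1), by simp [Pi.single_apply, apply_ite abs], ?_⟩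
      simp [Pi.single_apply, hi]
  · rintro _ ⟨w, hw, rfl⟩
    have hC := convex_convexHull ℝ (Set.range x ∪ -Set.range x)
    have hx : ∀ i, x i ∈ convexHull ℝ (Set.range x ∪ -Set.range x) := fun i =>
      subset_convexHull _ _ (Or.inl ⟨i, rfl⟩)
    have hx' : ∀ i, -x i ∈ convexHull ℝ (Set.range x ∪ -Set.range x) := fun i =>
      subset_convexHull _ _ (Or.inr ⟨i, by simp⟩)
    have h0 : (0 : EuclideanSpace ℝ (Fin n)) ∈ convexHull ℝ (Set.range x ∪ -Set.range x) := by
      have := hC (hx ⟨0, Nat.pos_of_ne_zero hn⟩) (hx' ⟨0, Nat.pos_of_ne_zero hn⟩)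
        (a := 1 / 2) (b := 1 / 2) (by norm_num) (by norm_num) (by norm_num)
      simpa using this
    have := hC.sum_mem_of_sum_le_one h0 (w := fun i => |w i|)
      (z := fun i => if 0 ≤ w i then x i else -x i) (fun i => abs_nonneg _) hw
      (fun i => by split_ifs; exacts [hx i, hx' i])
    convert this using 1
    simp only [smul_zero, zero_add]
    refine sum_congr rfl fun i _ => ?_
    split_ifs with h
    · rw [abs_of_nonneg h]
    · rw [abs_of_neg (not_le.1 h), smul_neg, neg_smul, neg_neg]

theorem convexHull_range_eq_vadd (x : Fin (n + 1) → EuclideanSpace ℝ (Fin n)) :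
    convexHull ℝ (Set.range x) =
      x 0 +ᵥ (fun w : Fin n → ℝ => ∑ i, w i • (x i.succ - x 0)) ''
        {w | (∀ i, 0 ≤ w i) ∧ ∑ i, w i ≤ 1} := by
  apply Set.Subset.antisymm
  · refine convexHull_min ?_ (((convex_cornerSimplex n).is_linear_image
      (isLinearMap_sum_smul fun i : Fin n => x i.succ - x 0)).vadd _)
    rintro _ ⟨i, rfl⟩
    rw [Set.mem_vadd_set]
    refine Fin.cases ?_ (fun i => ?_) i
    · exact ⟨0, ⟨0, by simp, by simp⟩, by simp⟩
    · refine ⟨x i.succ - x 0, ⟨Pi.single i 1, ⟨fun j => ?_, by simp⟩, by simp [Pi.single_apply]⟩,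
        by simp⟩
      by_cases h : j = i <;> simp [h]
  · rintro _ ⟨_, ⟨w, hw, rfl⟩, rfl⟩
    have := (convex_convexHull ℝ (Set.range x)).sum_mem_of_sum_le_one
      (subset_convexHull ℝ _ ⟨0, rfl⟩) hw.1 hw.2
      (z := fun i => x i.succ) (fun i => subset_convexHull ℝ _ ⟨i.succ, rfl⟩)
    convert this using 1
    simp only [vadd_eq_add, smul_sub, sum_sub_distrib, ← sum_smul, sub_smul, one_smul]
    abel

theorem volume_convexHull_range_union_neg (hn : n ≠ 0) (x : Fin n → EuclideanSpace ℝ (Fin n)) :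
    (volume (convexHull ℝ (Set.range x ∪ -Set.range x))).toReal =
      2 ^ n / n.factorial * |(Matrix.of fun b i => x i b).det| := by
  rw [convexHull_range_union_neg hn, volume_image_sum_smul, volume_l1Ball,
    ← ENNReal.ofReal_mul (abs_nonneg _), ENNReal.toReal_ofReal (by positivity), mul_comm]

theorem volume_convexHull_range (x : Fin (n + 1) → EuclideanSpace ℝ (Fin n)) :
    (volume (convexHull ℝ (Set.range x))).toReal =
      1 / n.factorial * |(Matrix.of fun (b : Fin (n + 1)) i =>
        (Fin.cons 1 (x i) : Fin (n + 1) → ℝ) b).det| := by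
  have hdet : (Matrix.of fun (b : Fin (n + 1)) i =>
        (Fin.cons 1 (x i) : Fin (n + 1) → ℝ) b).det =
      (Matrix.of fun b (i : Fin n) => (x i.succ - x 0) b).det := by
    rw [← Matrix.det_transpose, Matrix.det_eq_of_forall_row_eq_smul_add_const
      (B := Matrix.transpose <| Matrix.of fun (b : Fin (n + 1)) (i : Fin (n + 1)) =>
        (Fin.cons (if i = 0 then 1 else 0) (fun b => if i = 0 then x 0 b else x i b - x 0 b) :
          Fin (n + 1) → ℝ) b) (fun i => if i = 0 then 0 else 1) 0 (by simp) ?_,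
      Matrix.det_transpose]
    · rw [Matrix.det_succ_row_zero, Fin.sum_univ_succ]
      simp [Matrix.submatrix]
    · intro i b
      refine Fin.cases ?_ (fun b => ?_) b <;> refine Fin.cases ?_ (fun i => ?_) i <;> simp
  rw [convexHull_range_eq_vadd, measure_vadd, volume_image_sum_smul, volume_cornerSimplex, hdet,
    ← ENNReal.ofReal_mul (abs_nonneg _), ENNReal.toReal_ofReal (by positivity), mul_comm]

end HullVolumes

section Interpolation

theorem rpow_le_one_add_pow_four {u p : ℝ} (hu : 0 ≤ u) (hp1 : 1 ≤ p) (hp4 : p ≤ 4) :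
    u ^ p ≤ 1 + u ^ 4 := by
  rcases le_total u 1 with h | h
  · have := Real.rpow_le_one hu h (by linarith : 0 ≤ p)
    nlinarith [sq_nonneg (u ^ 2)]
  · have := Real.rpow_le_rpow_of_exponent_le h hp4
    rw [show (4 : ℝ) = ((4 : ℕ) : ℝ) by norm_num, Real.rpow_natCast] at this
    linarith

theorem sq_le_rpow_add_pow_four {u p P : ℝ} (hu : 0 ≤ u) (hp1 : 1 ≤ p) (hp4 : p ≤ 4)
    (hP : 0 < P) : u ^ 2 ≤ 1 / 4 + 32 * P * u ^ p + u ^ 4 / (2 * P) := by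
  have hup : 0 ≤ u ^ p := Real.rpow_nonneg hu p
  have h3 : 0 ≤ u ^ 4 / (2 * P) := by positivity
  have h2 : 0 ≤ 32 * P * u ^ p := by positivity
  rcases le_total u (1 / 2) with h | h
  · nlinarith
  rcases le_total (u ^ 2) (2 * P) with hL | hL
  · have h1 : (1 : ℝ) ≤ (2 * u) ^ p := Real.one_le_rpow (by linarith) (by linarith)
    have h16 : (2 : ℝ) ^ p ≤ 16 := by
      have := Real.rpow_le_rpow_of_exponent_le (by norm_num : (1 : ℝ) ≤ 2) hp4
      norm_num at this ⊢
      exact this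
    rw [Real.mul_rpow (by norm_num) hu] at h1
    have : 1 ≤ 16 * u ^ p := h1.trans (by gcongr)
    nlinarith
  · have : u ^ 2 ≤ u ^ 4 / (2 * P) := by
      rw [le_div_iff₀ (by positivity)]
      nlinarith [sq_nonneg u]
    linarith

variable {Ω : Type*} [MeasurableSpace Ω] {μ : Measure Ω} [IsProbabilityMeasure μ]

/-- A reverse Hölder inequality: if the fourth moment is comparable to the square of the second
moment, then all absolute moments of order `1 ≤ p ≤ 4` are comparable. -/
theorem rpow_moment_bounds {Z : Ω → ℝ} {p A P : ℝ} (hp1 : 1 ≤ p) (hp4 : p ≤ 4)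
    (hZm : AEStronglyMeasurable Z μ) (hZ4 : Integrable (fun x => Z x ^ 4) μ)
    (hA : 0 < A) (hP : 0 < P) (h2 : ∫ x, Z x ^ 2 ∂μ = A) (h4 : ∫ x, Z x ^ 4 ∂μ ≤ A ^ 2 * P) :
    A ^ (p / 2) / (128 * P) ≤ ∫ x, |Z x| ^ p ∂μ ∧
      ∫ x, |Z x| ^ p ∂μ ≤ A ^ (p / 2) * (1 + P) := by
  have hp0 : 0 < p := by linarith
  have hA2 : √A ^ 2 = A := Real.sq_sqrt hA.le
  have hsA : 0 < √A := Real.sqrt_pos.2 hA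
  set u : Ω → ℝ := fun x => |Z x| / √A with hu
  have hu0 : ∀ x, 0 ≤ u x := fun x => by positivity
  have hu4 : ∀ x, u x ^ 4 = Z x ^ 4 / A ^ 2 := fun x => by
    rw [hu, div_pow, show |Z x| ^ 4 = Z x ^ 4 from (by decide : Even 4).pow_abs _,
      show √A ^ 4 = (√A ^ 2) ^ 2 by ring, hA2]
  have hu2 : ∀ x, u x ^ 2 = Z x ^ 2 / A := fun x => by
    rw [hu, div_pow, sq_abs, hA2]
  have hup : ∀ x, |Z x| ^ p = A ^ (p / 2) * u x ^ p := fun x => by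
    rw [show A ^ (p / 2) = √A ^ p by
      rw [Real.sqrt_eq_rpow, ← Real.rpow_mul hA.le]; ring_nf,
      ← Real.mul_rpow hsA.le (hu0 x), hu]
    congr 1
    field_simp
  have hum : AEStronglyMeasurable u μ := by
    simpa only [hu, div_eq_mul_inv, Real.norm_eq_abs] using hZm.norm.mul_const (√A)⁻¹
  have hi4 : Integrable (fun x => u x ^ 4) μ := by
    simp only [hu4]; exact hZ4.div_const _
  have hip : Integrable (fun x => u x ^ p) μ := by
    refine ((integrable_const 1).add hi4).mono'
      ((Real.continuous_rpow_const hp0.le).comp_aestronglyMeasurable hum)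
      (ae_of_all _ fun x => ?_)
    rw [Real.norm_of_nonneg (Real.rpow_nonneg (hu0 x) p)]
    exact rpow_le_one_add_pow_four (hu0 x) hp1 hp4
  have hi2 : Integrable (fun x => u x ^ 2) μ := by
    refine ((integrable_const 1).add hi4).mono' (hum.pow 2) (ae_of_all _ fun x => ?_)
    rw [Real.norm_of_nonneg (by positivity)]
    simp only [Pi.add_apply]
    nlinarith [sq_nonneg (u x ^ 2 - 1), sq_nonneg (u x)]
  have e4 : ∫ x, u x ^ 4 ∂μ ≤ P := by
    simp only [hu4]
    rw [integral_div, div_le_iff₀ (by positivity), mul_comm]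
    exact h4
  have e2 : ∫ x, u x ^ 2 ∂μ = 1 := by
    simp only [hu2]
    rw [integral_div, h2, div_self hA.ne']
  have hub : ∫ x, u x ^ p ∂μ ≤ 1 + P := by
    calc _ ≤ ∫ x, (1 + u x ^ 4) ∂μ := integral_mono hip ((integrable_const 1).add hi4)
          fun x => rpow_le_one_add_pow_four (hu0 x) hp1 hp4
      _ = 1 + ∫ x, u x ^ 4 ∂μ := by rw [integral_add (integrable_const 1) hi4]; simp
      _ ≤ _ := by gcongr
  have hlb : 1 ≤ 1 / 4 + 32 * P * (∫ x, u x ^ p ∂μ) + P / (2 * P) := by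
    calc (1 : ℝ) = ∫ x, u x ^ 2 ∂μ := e2.symm
      _ ≤ ∫ x, (1 / 4 + 32 * P * u x ^ p + u x ^ 4 / (2 * P)) ∂μ :=
          integral_mono hi2 (((integrable_const _).add (hip.const_mul _)).add (hi4.div_const _))
            fun x => sq_le_rpow_add_pow_four (hu0 x) hp1 hp4 hP
      _ = 1 / 4 + 32 * P * (∫ x, u x ^ p ∂μ) + (∫ x, u x ^ 4 ∂μ) / (2 * P) := by
          have hi : Integrable (fun x => 1 / 4 + 32 * P * u x ^ p) μ :=
            (integrable_const _).add (hip.const_mul _)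
          rw [integral_add hi (hi4.div_const _), integral_add (integrable_const _)
            (hip.const_mul _), integral_const_mul, integral_div (2 * P)]
          simp
      _ ≤ _ := by gcongr
  have hhalf : P / (2 * P) = 1 / 2 := by field_simp
  have hAp : 0 < A ^ (p / 2) := Real.rpow_pos_of_pos hA _
  simp only [hup]
  rw [integral_const_mul]
  refine ⟨?_, by gcongr⟩
  rw [div_eq_mul_one_div]
  gcongr
  rw [div_le_iff₀ (by positivity)]
  linarith

end Interpolation

section RootLimits

open Topology

theorem tendsto_const_mul_pow_rpow_inv {K : ℝ} (hK : 0 < K) (d : ℝ) (c : ℕ) :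
    Tendsto (fun n : ℕ => (K * ((n : ℝ) + d) ^ c) ^ ((n : ℝ)⁻¹)) atTop (𝓝 1) := by
  have hadd : Tendsto (fun n : ℕ => (n : ℝ) + d) atTop atTop :=
    tendsto_atTop_add_const_right _ _ tendsto_natCast_atTop_atTop
  have h1 : Tendsto (fun n : ℕ => K ^ ((n : ℝ)⁻¹)) atTop (𝓝 1) := by
    have := (Real.continuousAt_const_rpow (b := 0) hK.ne').tendsto.comp
      (tendsto_inv_atTop_zero.comp (tendsto_natCast_atTop_atTop (R := ℝ)))
    simpa [Function.comp_def] using this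
  have h2 : Tendsto (fun n : ℕ => ((n : ℝ) + d) ^ ((n : ℝ)⁻¹)) atTop (𝓝 1) := by
    have := (tendsto_rpow_div_mul_add 1 1 (-d) zero_ne_one).comp hadd
    refine this.congr fun n => ?_
    simp
  have h3 := h1.mul (h2.pow c)
  rw [one_pow, one_mul] at h3
  refine h3.congr' ?_
  filter_upwards [hadd.eventually_gt_atTop 0] with n hn
  rw [Real.mul_rpow hK.le (by positivity), Real.rpow_pow_comm hn.le]

theorem tendsto_sqrt_mul_root {I a : ℕ → ℝ} {p ℓ d : ℝ} {c : ℕ} (hp : 0 < p) (hd : 0 < d)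
    (ha : ∀ᶠ n in atTop, 0 < a n)
    (hlow : ∀ᶠ n : ℕ in atTop, a n ^ (p / 2) / (128 * ((n : ℝ) + d) ^ c) ≤ I n)
    (hup : ∀ᶠ n : ℕ in atTop, I n ≤ a n ^ (p / 2) * (1 + ((n : ℝ) + d) ^ c))
    (hlim : Tendsto (fun n : ℕ => n * a n ^ ((n : ℝ)⁻¹)) atTop (𝓝 ℓ)) :
    Tendsto (fun n : ℕ => √n * (I n ^ (1 / p)) ^ ((n : ℝ)⁻¹)) atTop (𝓝 √ℓ) := by
  have hR : Tendsto (fun n : ℕ => (I n / a n ^ (p / 2)) ^ ((n : ℝ)⁻¹)) atTop (𝓝 1) := by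
    have hu := tendsto_const_mul_pow_rpow_inv (by norm_num : (0 : ℝ) < 128) (d + 1) c
    have hl := hu.inv₀ one_ne_zero
    rw [inv_one] at hl
    refine tendsto_of_tendsto_of_tendsto_of_le_of_le' hl hu ?_ ?_
    · filter_upwards [ha, hlow] with n han h
      have hA : 0 < a n ^ (p / 2) := Real.rpow_pos_of_pos han _
      rw [← Real.inv_rpow (by positivity)]
      refine Real.rpow_le_rpow (by positivity) ?_ (by positivity)
      rw [le_div_iff₀ hA]
      refine le_trans ?_ h
      rw [inv_mul_eq_div]
      gcongr
      linarith
    · filter_upwards [ha, hlow, hup] with n han h' h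
      have hA : 0 < a n ^ (p / 2) := Real.rpow_pos_of_pos han _
      have hI : 0 ≤ I n := le_trans (by positivity) h'
      gcongr
      rw [div_le_iff₀ hA, mul_comm]
      refine h.trans ?_
      gcongr
      have h1 : ((n : ℝ) + d) ^ c ≤ ((n : ℝ) + (d + 1)) ^ c := by gcongr; linarith
      have h2 : 1 ≤ ((n : ℝ) + (d + 1)) ^ c := one_le_pow₀ (by linarith [n.cast_nonneg (α := ℝ)])
      linarith
  have h := (Real.continuous_sqrt.tendsto ℓ |>.comp hlim).mul
    (hR.rpow_const (p := 1 / p) (Or.inl one_ne_zero))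
  rw [Real.one_rpow, mul_one] at h
  refine h.congr' ?_
  filter_upwards [ha, hlow] with n han hl
  have hA : 0 < a n ^ (p / 2) := Real.rpow_pos_of_pos han _
  have hI : 0 ≤ I n := le_trans (by positivity) hl
  simp only [Function.comp]
  rw [Real.sqrt_mul (Nat.cast_nonneg n), mul_assoc]
  congr 1
  rw [← Real.rpow_mul (by positivity), Real.div_rpow hI hA.le, ← Real.rpow_mul han.le,
    Real.sqrt_eq_rpow, ← Real.rpow_mul han.le, ← Real.rpow_mul hI, mul_comm (n : ℝ)⁻¹ (1 / p),
    show p / 2 * (1 / p * (n : ℝ)⁻¹) = (n : ℝ)⁻¹ * (1 / 2) by field_simp]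
  have : 0 < a n ^ ((n : ℝ)⁻¹ * (1 / 2)) := Real.rpow_pos_of_pos han _
  field_simp

theorem Real.Gamma_add_le_mul_rpow {x s : ℝ} (hx : 0 < x) (hs : 0 < s) (hs1 : s ≤ 1) :
    Real.Gamma (x + s) ≤ Real.Gamma x * x ^ s := by
  rcases hs1.eq_or_lt with rfl | hs1
  · rw [Real.Gamma_add_one hx.ne', Real.rpow_one, mul_comm]
  have h := Real.Gamma_mul_add_mul_le_rpow_Gamma_mul_rpow_Gamma hx (by linarith : 0 < x + 1)
    (sub_pos.2 hs1) hs (by ring)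
  have hΓ := Real.Gamma_pos_of_pos hx
  rw [Real.Gamma_add_one hx.ne', Real.mul_rpow hx.le hΓ.le, mul_left_comm,
    ← Real.rpow_add hΓ, sub_add_cancel, Real.rpow_one] at h
  rw [mul_comm (Real.Gamma x)]
  convert h using 2
  ring

theorem tendsto_Gamma_add_div {s : ℝ} (hs : 0 < s) (hs1 : s ≤ 1) :
    Tendsto (fun x => Real.Gamma (x + s) / (Real.Gamma x * x ^ s)) atTop (𝓝 1) := by
  rcases hs1.eq_or_lt with rfl | hs1
  · refine tendsto_const_nhds.congr' ?_
    filter_upwards [eventually_gt_atTop 0] with x hx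
    have := Real.Gamma_pos_of_pos hx
    rw [Real.Gamma_add_one hx.ne', Real.rpow_one, mul_comm, div_self (by positivity)]
  have hlow : Tendsto (fun x : ℝ => (x / (x + s)) ^ (1 - s)) atTop (𝓝 1) := by
    have h : Tendsto (fun x : ℝ => 1 - s / (x + s)) atTop (𝓝 (1 - 0)) :=
      tendsto_const_nhds.sub
        (tendsto_const_nhds.div_atTop (tendsto_atTop_add_const_right _ s tendsto_id))
    rw [sub_zero] at h
    have h' := h.rpow_const (p := 1 - s) (Or.inl one_ne_zero)
    rw [Real.one_rpow] at h'
    refine h'.congr' ?_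
    filter_upwards [eventually_gt_atTop 0] with x hx
    congr 1
    field_simp
    ring
  refine tendsto_of_tendsto_of_tendsto_of_le_of_le' hlow tendsto_const_nhds ?_ ?_
  · filter_upwards [eventually_gt_atTop 0] with x hx
    have hΓ := Real.Gamma_pos_of_pos hx
    have h := Real.Gamma_add_le_mul_rpow (by linarith : 0 < x + s) (sub_pos.2 hs1) (by linarith)
    rw [show x + s + (1 - s) = x + 1 by ring, Real.Gamma_add_one hx.ne'] at h
    rw [Real.div_rpow hx.le (by positivity), div_le_div_iff₀ (by positivity) (by positivity)]
    calc x ^ (1 - s) * (Real.Gamma x * x ^ s) = x * Real.Gamma x := by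
          rw [mul_comm (Real.Gamma x), ← mul_assoc, ← Real.rpow_add hx, sub_add_cancel,
            Real.rpow_one]
      _ ≤ _ := h
  · filter_upwards [eventually_gt_atTop 0] with x hx
    have hΓ := Real.Gamma_pos_of_pos hx
    rw [div_le_one (by positivity)]
    exact Real.Gamma_add_le_mul_rpow hx hs hs1.le

end RootLimits

section GammaLimits

open Topology

theorem tendsto_rpow_inv_of_tendsto_ratio {a : ℕ → ℝ} {L : ℝ} (ha : ∀ n, 0 < a n) (hL : 0 < L)
    (h : Tendsto (fun n => a (n + 1) / a n) atTop (𝓝 L)) :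
    Tendsto (fun n : ℕ => a n ^ ((n : ℝ)⁻¹)) atTop (𝓝 L) := by
  have h1 := ((Real.continuousAt_log hL.ne').tendsto.comp h).cesaro
  have h2 : Tendsto (fun n : ℕ => (n : ℝ)⁻¹ * Real.log (a 0)) atTop (𝓝 0) := by
    simpa [Function.comp_def] using
      (tendsto_inv_atTop_zero.comp (tendsto_natCast_atTop_atTop (R := ℝ))).mul_const
        (Real.log (a 0))
  have h3 := (Real.continuous_exp.tendsto _).comp (h1.add h2)
  rw [add_zero, Real.exp_log hL] at h3
  refine h3.congr fun n => ?_
  have hsum : ∑ i ∈ Finset.range n, (Real.log ∘ fun n => a (n + 1) / a n) i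
      = Real.log (a n) - Real.log (a 0) := by
    rw [← Finset.sum_range_sub (fun i => Real.log (a i))]
    exact Finset.sum_congr rfl fun i _ => Real.log_div (ha _).ne' (ha _).ne'
  simp only [Function.comp_apply] at hsum ⊢
  rw [hsum, Real.rpow_def_of_pos (ha n)]
  ring_nf

variable {t : ℝ}

theorem tendsto_nat_mul_add_div (t b c : ℝ) :
    Tendsto (fun n : ℕ => (n * t + b) / (n + c)) atTop (𝓝 t) := by
  have hadd : Tendsto (fun n : ℕ => (n : ℝ) + c) atTop atTop :=
    tendsto_atTop_add_const_right _ _ tendsto_natCast_atTop_atTop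
  have h := (tendsto_const_nhds (x := t)).add (hadd.const_div_atTop (b - c * t))
  rw [add_zero] at h
  refine h.congr' ?_
  filter_upwards [hadd.eventually_gt_atTop 0] with n hn
  field_simp
  ring

theorem tendsto_Gamma_rpow_inv (ht : 0 < t) (ht1 : t ≤ 1) :
    Tendsto (fun n : ℕ => (Real.Gamma (n * t + 1) / ((n : ℝ) ^ n) ^ t) ^ ((n : ℝ)⁻¹)) atTop
      (𝓝 (t ^ t * (Real.exp 1)⁻¹ ^ t)) := by
  have hx : Tendsto (fun n : ℕ => (n : ℝ) * t + 1) atTop atTop :=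
    tendsto_atTop_add_const_right _ _ (tendsto_natCast_atTop_atTop.atTop_mul_const ht)
  have hpow : ∀ n : ℕ, (0 : ℝ) < (n : ℝ) ^ n := fun n => by
    rcases n.eq_zero_or_pos with rfl | hn
    · simp
    · positivity
  have hΓ : ∀ n : ℕ, 0 < Real.Gamma (n * t + 1) := fun n => Real.Gamma_pos_of_pos (by positivity)
  refine tendsto_rpow_inv_of_tendsto_ratio (fun n => ?_) (by positivity) ?_
  · have := hpow n
    have := hΓ n
    positivity
  have h1 := (tendsto_Gamma_add_div ht ht1).comp hx
  have h2 := (tendsto_nat_mul_add_div t 1 1).rpow_const (p := t) (Or.inl ht.ne')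
  have h3 := ((Real.tendsto_one_add_div_pow_exp 1).inv₀ (Real.exp_pos 1).ne').rpow_const
    (p := t) (Or.inl (by positivity))
  have h := h1.mul (h2.mul h3)
  rw [one_mul] at h
  refine h.congr' ?_
  filter_upwards [eventually_gt_atTop 0] with n hn
  have hn' : (0 : ℝ) < n := by exact_mod_cast hn
  have := hΓ n
  have h4 : (1 + 1 / (n : ℝ)) ^ n = ((n : ℝ) + 1) ^ n / (n : ℝ) ^ n := by
    rw [← div_pow]; congr 1; field_simp
  simp only [Function.comp_apply]
  push_cast
  rw [h4, inv_div, Real.div_rpow (by positivity) (by positivity),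
    Real.div_rpow (by positivity) (by positivity), pow_succ,
    Real.mul_rpow (by positivity) (by positivity), show ((n : ℝ) + 1) * t + 1 = n * t + 1 + t by ring]
  field_simp

theorem tendsto_Gamma_div_Gamma (ht : 0 < t) (ht1 : t ≤ 1) :
    Tendsto (fun n : ℕ => Real.Gamma (n * t + 1) / Real.Gamma (n * t + 2 * t + 1) *
      ((n : ℝ) ^ t) ^ 2) atTop (𝓝 ((t ^ t) ^ 2)⁻¹) := by
  have hx : Tendsto (fun n : ℕ => (n : ℝ) * t + 1) atTop atTop :=
    tendsto_atTop_add_const_right _ _ (tendsto_natCast_atTop_atTop.atTop_mul_const ht)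
  have h1 := (tendsto_Gamma_add_div ht ht1).comp hx
  have h2 := (tendsto_Gamma_add_div ht ht1).comp (tendsto_atTop_add_const_right _ t hx)
  have h3 := (tendsto_nat_mul_add_div t 1 0).rpow_const (p := t) (Or.inl ht.ne')
  have h4 := (tendsto_nat_mul_add_div t (1 + t) 0).rpow_const (p := t) (Or.inl ht.ne')
  have h := ((h1.mul h2).mul (h3.mul h4)).inv₀ (by positivity)
  rw [one_mul, one_mul, ← sq] at h
  refine h.congr' ?_
  filter_upwards [eventually_gt_atTop 0] with n hn
  have hn' : (0 : ℝ) < n := by exact_mod_cast hn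
  have g0 : 0 < Real.Gamma (n * t + 1) := Real.Gamma_pos_of_pos (by positivity)
  have g1 : 0 < Real.Gamma (n * t + 1 + t) := Real.Gamma_pos_of_pos (by positivity)
  have g2 : 0 < Real.Gamma (n * t + 1 + t + t) := Real.Gamma_pos_of_pos (by positivity)
  simp only [Function.comp_apply, add_zero]
  rw [Real.div_rpow (by positivity) (by positivity),
    Real.div_rpow (by positivity) (by positivity), ← add_assoc,
    show (n : ℝ) * t + 2 * t + 1 = n * t + 1 + t + t by ring]
  field_simp

end GammaLimits

section Constants

open Topology

/-- The volume of the unit ball of `ℓ_qⁿ`, in terms of `t = 1 / q`. -/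
noncomputable def lqVolume (n : ℕ) (t : ℝ) : ℝ :=
  (2 * t * Real.Gamma t) ^ n / Real.Gamma (n * t + 1)

/-- The variance of a coordinate of a uniform point in the unit ball of `ℓ_qⁿ`,
in terms of `t = 1 / q`. -/
noncomputable def lqVariance (n : ℕ) (t : ℝ) : ℝ :=
  Real.Gamma (3 * t) / Real.Gamma t * (Real.Gamma (n * t + 1) / Real.Gamma (n * t + 2 * t + 1))

/-- The second moment of `|det (x₁, …, xₙ)| / (n! vol)` for independent uniform points of the
unit ball of `ℓ_qⁿ`, in terms of `t = 1 / q`. -/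
noncomputable def lqSimplexSecondMoment (n : ℕ) (t : ℝ) : ℝ :=
  lqVariance n t ^ n / (n.factorial * lqVolume n t ^ 2)

variable {t : ℝ}

theorem lqVolume_pos (ht : 0 < t) (n : ℕ) : 0 < lqVolume n t := by
  have := Real.Gamma_pos_of_pos ht
  have : 0 < Real.Gamma (n * t + 1) := Real.Gamma_pos_of_pos (by positivity)
  unfold lqVolume
  positivity

theorem lqVariance_pos (ht : 0 < t) (n : ℕ) : 0 < lqVariance n t := by
  have := Real.Gamma_pos_of_pos ht
  have : 0 < Real.Gamma (3 * t) := Real.Gamma_pos_of_pos (by positivity)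
  have : 0 < Real.Gamma (n * t + 1) := Real.Gamma_pos_of_pos (by positivity)
  have : 0 < Real.Gamma (n * t + 2 * t + 1) := Real.Gamma_pos_of_pos (by positivity)
  unfold lqVariance
  positivity

theorem lqSimplexSecondMoment_pos (ht : 0 < t) (n : ℕ) : 0 < lqSimplexSecondMoment n t := by
  have := lqVolume_pos ht n
  have := lqVariance_pos ht n
  unfold lqSimplexSecondMoment
  positivity

theorem alphaFn_eq (ht : 0 < t) : alphaFn t / 4 =
    Real.Gamma (3 * t) / Real.Gamma t * ((t ^ t) ^ 2)⁻¹ * (t ^ t * (Real.exp 1)⁻¹ ^ t) ^ 2 /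
      ((Real.exp 1)⁻¹ * (2 * t * Real.Gamma t) ^ 2) := by
  have := Real.Gamma_pos_of_pos ht
  have : 0 < t ^ t := Real.rpow_pos_of_pos ht t
  have he : (Real.exp 1)⁻¹ ^ t = Real.exp (-t) := by rw [← Real.exp_neg, ← Real.exp_mul]; ring_nf
  rw [alphaFn, add_comm 1 (3 * t), add_comm 1 t, Real.Gamma_add_one ht.ne',
    Real.Gamma_add_one (by positivity), he, mul_pow (t ^ t), ← Real.exp_nat_mul, ← Real.exp_neg,
    show 1 - 2 * t = ((2 : ℕ) : ℝ) * -t - -1 by push_cast; ring, Real.exp_sub]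
  field_simp
  norm_num

theorem tendsto_lqSimplexSecondMoment_rpow_inv (ht : 0 < t) (ht1 : t ≤ 1) :
    Tendsto (fun n : ℕ => n * lqSimplexSecondMoment n t ^ ((n : ℝ)⁻¹)) atTop
      (𝓝 (alphaFn t / 4)) := by
  have hΓ := Real.Gamma_pos_of_pos ht
  have h1 := tendsto_Gamma_div_Gamma ht ht1
  have h2 := tendsto_Gamma_rpow_inv ht ht1
  have h3 := tendsto_Gamma_rpow_inv one_pos le_rfl
  simp only [Real.rpow_one, one_mul, mul_one, Real.Gamma_nat_eq_factorial] at h3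
  have h := ((h1.const_mul (Real.Gamma (3 * t) / Real.Gamma t)).mul (h2.pow 2)).div
    (h3.mul_const ((2 * t * Real.Gamma t) ^ 2)) (by positivity)
  rw [alphaFn_eq ht]
  refine h.congr' ?_
  filter_upwards [eventually_gt_atTop 0] with n hn
  have hn' : (0 : ℝ) < n := by exact_mod_cast hn
  have hs := lqVariance_pos ht n
  have hg : 0 < Real.Gamma (n * t + 1) := Real.Gamma_pos_of_pos (by positivity)
  have hroot : ∀ {x : ℝ}, 0 ≤ x → (x ^ n) ^ ((n : ℝ)⁻¹) = x := fun hx =>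
    Real.pow_rpow_inv_natCast hx hn.ne'
  have e1 : (((n : ℝ) ^ n) ^ t) ^ ((n : ℝ)⁻¹) = (n : ℝ) ^ t := by
    rw [← Real.rpow_natCast_mul hn'.le, ← Real.rpow_mul hn'.le]
    congr 1
    field_simp
  have eR : lqSimplexSecondMoment n t ^ ((n : ℝ)⁻¹) = lqVariance n t /
      ((n.factorial : ℝ) ^ ((n : ℝ)⁻¹) *
        (2 * t * Real.Gamma t / Real.Gamma (n * t + 1) ^ ((n : ℝ)⁻¹)) ^ 2) := by
    rw [lqSimplexSecondMoment, lqVolume, Real.div_rpow (by positivity) (by positivity),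
      hroot hs.le, Real.mul_rpow (by positivity) (by positivity),
      ← Real.rpow_pow_comm (by positivity), Real.div_rpow (by positivity) hg.le,
      hroot (by positivity)]
  simp only [Pi.div_apply]
  rw [eR, Real.div_rpow hg.le (by positivity), e1,
    Real.div_rpow (by positivity) (by positivity), hroot hn'.le, lqVariance]
  have : 0 < Real.Gamma (n * t + 1) ^ ((n : ℝ)⁻¹) := by positivity
  field_simp

end Constants

section Moments

variable {n : ℕ} {q : ℝ}

theorem measurableSet_lqBall : MeasurableSet (lqBall n q) := by
  have : ∀ i : Fin n, Measurable fun x : EuclideanSpace ℝ (Fin n) => |x i| ^ q := fun i => by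
    have : Measurable fun x : EuclideanSpace ℝ (Fin n) => x i := by fun_prop
    exact this.abs.pow_const q
  exact measurableSet_le (Finset.measurable_sum _ fun i _ => this i) measurable_const

theorem lintegral_lqBall_prod_abs_pow (hq : 0 < q) (s : Fin n → ℕ) :
    ∫⁻ x in lqBall n q, ENNReal.ofReal (∏ i, |x i| ^ s i) =
      ENNReal.ofReal ((∏ i, (2 / q * Real.Gamma ((s i + 1) / q))) /
        Real.Gamma ((n + ∑ i, s i : ℝ) / q + 1)) := by
  rw [← lintegral_prod_abs_pow hq s,
    ← (PiLp.volume_preserving_toLp (Fin n)).setLIntegral_comp_preimage_emb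
      (MeasurableEquiv.toLp 2 (Fin n → ℝ)).measurableEmbedding]
  rfl

theorem volume_lqBall (hq : 0 < q) :
    volume (lqBall n q) = ENNReal.ofReal (lqVolume n (1 / q)) := by
  have h := lintegral_lqBall_prod_abs_pow (n := n) hq 0
  simp only [Pi.zero_apply, pow_zero, Finset.prod_const_one, ENNReal.ofReal_one,
    lintegral_const, one_mul, Measure.restrict_apply_univ] at h
  rw [h, lqVolume]
  simp [div_eq_mul_inv]

theorem isProbabilityMeasure_unifMeasure_lqBall (hq : 0 < q) :
    IsProbabilityMeasure (unifMeasure n (lqBall n q)) := by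
  have hv := lqVolume_pos (one_div_pos.2 hq) n
  refine ⟨?_⟩
  rw [unifMeasure, Measure.smul_apply, Measure.restrict_apply_univ, smul_eq_mul,
    volume_lqBall hq]
  exact ENNReal.inv_mul_cancel (by simpa using hv) ENNReal.ofReal_ne_top

theorem ae_abs_le_one_unifMeasure_lqBall (hq : 0 < q) (i : Fin n) :
    ∀ᵐ x ∂unifMeasure n (lqBall n q), |x i| ≤ 1 := by
  refine Measure.ae_smul_measure ?_ _
  filter_upwards [ae_restrict_mem measurableSet_lqBall] with x hx
  have h : |x i| ^ q ≤ 1 := (Finset.single_le_sum (f := fun i => |x i| ^ q)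
    (fun j _ => by positivity) (Finset.mem_univ i)).trans hx
  by_contra! h1
  exact absurd (Real.one_lt_rpow h1 hq) (not_lt.2 h)

theorem integral_unifMeasure_lqBall_prod_abs_pow (hq : 0 < q) (s : Fin n → ℕ) :
    ∫ x, ∏ i, |x i| ^ s i ∂unifMeasure n (lqBall n q) =
      (∏ i, (Real.Gamma ((s i + 1) * (1 / q)) / Real.Gamma (1 / q))) *
        (Real.Gamma (n * (1 / q) + 1) / Real.Gamma (n * (1 / q) + (∑ i, s i : ℕ) * (1 / q) + 1)) := by
  have hq' : 0 < 1 / q := one_div_pos.2 hq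
  have hv := lqVolume_pos hq' n
  have hΓ := Real.Gamma_pos_of_pos hq'
  have hm : Measurable fun x : EuclideanSpace ℝ (Fin n) => ∏ i, |x i| ^ s i := by
    refine Finset.measurable_prod _ fun i _ => ?_
    have : Measurable fun x : EuclideanSpace ℝ (Fin n) => x i := by fun_prop
    exact this.abs.pow_const _
  have h1 : 0 ≤ (∏ i, (2 / q * Real.Gamma ((s i + 1) / q))) /
      Real.Gamma ((n + ∑ i, s i : ℝ) / q + 1) := by
    refine div_nonneg (Finset.prod_nonneg fun i _ => ?_) ?_
    · have := Real.Gamma_pos_of_pos (s := (s i + 1 : ℝ) / q) (by positivity)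
      positivity
    · exact (Real.Gamma_pos_of_pos (by positivity)).le
  rw [unifMeasure, integral_smul_measure, integral_eq_lintegral_of_nonneg_ae
    (ae_of_all _ fun x => Finset.prod_nonneg fun i _ => by positivity) hm.aestronglyMeasurable,
    lintegral_lqBall_prod_abs_pow hq, ENNReal.toReal_ofReal h1, volume_lqBall hq,
    ENNReal.toReal_inv, ENNReal.toReal_ofReal hv.le, smul_eq_mul, lqVolume,
    Finset.prod_mul_distrib, Finset.prod_div_distrib, Finset.prod_const, Finset.prod_const,
    Finset.card_univ, Fintype.card_fin]
  push_cast
  have e : ((n : ℝ) + ∑ i, (s i : ℝ)) / q + 1 = n * (1 / q) + (∑ i, (s i : ℝ)) * (1 / q) + 1 := by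
    ring
  have e' : ∀ i, ((s i : ℝ) + 1) / q = (s i + 1) * (1 / q) := fun i => by ring
  simp only [e, e']
  have g1 : 0 < Real.Gamma (n * (1 / q) + 1) := Real.Gamma_pos_of_pos (by positivity)
  have g2 : 0 < Real.Gamma (n * (1 / q) + (∑ i, (s i : ℝ)) * (1 / q) + 1) :=
    Real.Gamma_pos_of_pos (by positivity)
  simp only [Finset.prod_div_distrib, Finset.prod_const, Finset.card_univ, Fintype.card_fin]
  rw [mul_pow, mul_one_div]
  field_simp
  rw [← mul_pow, div_mul_cancel₀ _ hq.ne']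

theorem integral_unifMeasure_lqBall_sq (hq : 0 < q) (a : Fin n) :
    ∫ x, x a ^ 2 ∂unifMeasure n (lqBall n q) = lqVariance n (1 / q) := by
  have hΓ : Real.Gamma q⁻¹ ≠ 0 := (Real.Gamma_pos_of_pos (inv_pos.2 hq)).ne'
  have h := integral_unifMeasure_lqBall_prod_abs_pow hq (Pi.single a 2)
  have e : ∀ x : EuclideanSpace ℝ (Fin n), ∏ i, |x i| ^ (Pi.single a 2 : Fin n → ℕ) i = x a ^ 2 :=
    fun x => by
      rw [Fintype.prod_eq_single a fun i hi => by simp [hi]]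
      simp
  simp only [e] at h
  rw [h, Fintype.prod_eq_single a fun i hi => by simp [hi, hΓ], Finset.sum_pi_single',
    lqVariance]
  norm_num

theorem integral_unifMeasure_lqBall_pow_four (hq : 0 < q) (a : Fin n) :
    ∫ x, x a ^ 4 ∂unifMeasure n (lqBall n q) = Real.Gamma (5 * (1 / q)) / Real.Gamma (1 / q) *
      (Real.Gamma (n * (1 / q) + 1) / Real.Gamma (n * (1 / q) + 4 * (1 / q) + 1)) := by
  have hΓ : Real.Gamma q⁻¹ ≠ 0 := (Real.Gamma_pos_of_pos (inv_pos.2 hq)).ne'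
  have h := integral_unifMeasure_lqBall_prod_abs_pow hq (Pi.single a 4)
  have e : ∀ x : EuclideanSpace ℝ (Fin n), ∏ i, |x i| ^ (Pi.single a 4 : Fin n → ℕ) i = x a ^ 4 :=
    fun x => by
      rw [Fintype.prod_eq_single a fun i hi => by simp [hi]]
      simp [(by decide : Even 4).pow_abs]
  simp only [e] at h
  rw [h, Fintype.prod_eq_single a fun i hi => by simp [hi, hΓ], Finset.sum_pi_single']
  norm_num

theorem integral_unifMeasure_lqBall_sq_mul_sq (hq : 0 < q) {a b : Fin n} (hab : a ≠ b) :
    ∫ x, x a ^ 2 * x b ^ 2 ∂unifMeasure n (lqBall n q) =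
      (Real.Gamma (3 * (1 / q)) / Real.Gamma (1 / q)) ^ 2 *
      (Real.Gamma (n * (1 / q) + 1) / Real.Gamma (n * (1 / q) + 4 * (1 / q) + 1)) := by
  have hΓ : Real.Gamma q⁻¹ ≠ 0 := (Real.Gamma_pos_of_pos (inv_pos.2 hq)).ne'
  have h := integral_unifMeasure_lqBall_prod_abs_pow hq (Pi.single a 2 + Pi.single b 2)
  have e : ∀ x : EuclideanSpace ℝ (Fin n),
      ∏ i, |x i| ^ (Pi.single a 2 + Pi.single b 2 : Fin n → ℕ) i = x a ^ 2 * x b ^ 2 :=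
    fun x => by
      rw [Fintype.prod_eq_mul a b hab fun i hi => by simp [hi.1, hi.2]]
      simp [hab, hab.symm]
  simp only [e] at h
  rw [h, Fintype.prod_eq_mul a b hab fun i hi => by simp [hi.1, hi.2, hΓ]]
  simp only [Pi.add_apply, Finset.sum_add_distrib, Finset.sum_pi_single']
  simp [hab, hab.symm]
  norm_num [sq]

theorem Real.Gamma_add_sq_le {x s : ℝ} (hx : 0 < x) (hs : 0 < s) :
    Real.Gamma (x + s) ^ 2 ≤ Real.Gamma x * Real.Gamma (x + 2 * s) := by
  have h := Real.Gamma_mul_add_mul_le_rpow_Gamma_mul_rpow_Gamma hx (by positivity : 0 < x + 2 * s)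
    (half_pos one_pos) (half_pos one_pos) (add_halves 1)
  have h1 := Real.Gamma_pos_of_pos hx
  have h2 := Real.Gamma_pos_of_pos (by positivity : 0 < x + 2 * s)
  have h3 := Real.Gamma_pos_of_pos (by positivity : 0 < x + s)
  rw [← Real.mul_rpow h1.le h2.le, ← Real.sqrt_eq_rpow,
    show 1 / 2 * x + 1 / 2 * (x + 2 * s) = x + s by ring] at h
  exact (Real.le_sqrt h3.le (by positivity)).1 h

theorem Gamma_div_Gamma_le_sq {t : ℝ} (ht : 0 < t) (n : ℕ) :
    Real.Gamma (n * t + 1) / Real.Gamma (n * t + 4 * t + 1) ≤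
      (Real.Gamma (n * t + 1) / Real.Gamma (n * t + 2 * t + 1)) ^ 2 := by
  have h1 := Real.Gamma_pos_of_pos (by positivity : 0 < n * t + 1)
  have h2 := Real.Gamma_pos_of_pos (by positivity : 0 < n * t + 2 * t + 1)
  have h4 := Real.Gamma_pos_of_pos (by positivity : 0 < n * t + 4 * t + 1)
  have h := Real.Gamma_add_sq_le (by positivity : 0 < n * t + 1) (by positivity : 0 < 2 * t)
  rw [show n * t + 1 + 2 * t = n * t + 2 * t + 1 by ring,
    show n * t + 1 + 2 * (2 * t) = n * t + 4 * t + 1 by ring] at h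
  rw [div_pow, div_le_div_iff₀ h4 (by positivity)]
  nlinarith

theorem integral_unifMeasure_lqBall_sq_mul_sq_le (hq : 0 < q) {a b : Fin n} (hab : a ≠ b) :
    ∫ x, x a ^ 2 * x b ^ 2 ∂unifMeasure n (lqBall n q) ≤ lqVariance n (1 / q) ^ 2 := by
  rw [integral_unifMeasure_lqBall_sq_mul_sq hq hab, lqVariance, mul_pow]
  gcongr
  exact Gamma_div_Gamma_le_sq (one_div_pos.2 hq) n

/-- The kurtosis bound, uniform in the dimension, for coordinates of a uniform point in the unit
ball of `ℓ_qⁿ`, in terms of `t = 1 / q`. -/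
noncomputable def lqKurtosis (t : ℝ) : ℝ :=
  Real.Gamma (5 * t) * Real.Gamma t / Real.Gamma (3 * t) ^ 2

theorem integral_unifMeasure_lqBall_pow_four_le (hq : 0 < q) (a : Fin n) :
    ∫ x, x a ^ 4 ∂unifMeasure n (lqBall n q) ≤
      lqVariance n (1 / q) ^ 2 * lqKurtosis (1 / q) := by
  have ht := one_div_pos.2 hq
  rw [integral_unifMeasure_lqBall_pow_four hq]
  generalize 1 / q = t at ht ⊢
  have h1 := Real.Gamma_pos_of_pos ht
  have h3 := Real.Gamma_pos_of_pos (by positivity : 0 < 3 * t)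
  have h5 := Real.Gamma_pos_of_pos (by positivity : 0 < 5 * t)
  calc _ ≤ Real.Gamma (5 * t) / Real.Gamma t *
        (Real.Gamma (n * t + 1) / Real.Gamma (n * t + 2 * t + 1)) ^ 2 := by
        gcongr
        exact Gamma_div_Gamma_le_sq ht n
    _ = _ := by
        rw [lqVariance, lqKurtosis]
        field_simp

end Moments

section SignSymmetry

variable {Ω : Type*} [MeasurableSpace Ω] {N : ℕ}

/-- A family of random variables whose joint law is invariant, up to a global sign, under changing
the sign of any single member. -/
def SignSymmetric (ν : Measure Ω) (Y : Fin N → Ω → ℝ) : Prop :=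
  ∀ a, ∃ (φ : Ω ≃ᵐ Ω) (ε : ℝ), MeasurePreserving φ ν ν ∧ ε ^ 2 = 1 ∧
    ∀ b x, Y b (φ x) = ε * if b = a then -Y b x else Y b x

variable {ν : Measure Ω} {Y : Fin N → Ω → ℝ}

theorem MeasureTheory.MeasurePreserving.integral_eq_zero_of_comp_eq_neg {φ : Ω ≃ᵐ Ω}
    (hφ : MeasurePreserving φ ν ν) {f : Ω → ℝ} (h : ∀ x, f (φ x) = -f x) : ∫ x, f x ∂ν = 0 := by
  have := hφ.integral_comp' f
  simp only [h, integral_neg] at this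
  linarith

theorem SignSymmetric.integral_mul_eq_zero (h : SignSymmetric ν Y) {a b : Fin N} (hab : a ≠ b) :
    ∫ x, Y a x * Y b x ∂ν = 0 := by
  obtain ⟨φ, ε, hφ, hε, hY⟩ := h a
  refine hφ.integral_eq_zero_of_comp_eq_neg fun x => ?_
  rw [hY, hY, if_pos rfl, if_neg hab.symm]
  linear_combination (-Y a x * Y b x) * hε

theorem SignSymmetric.integral_mul_mul_mul_eq_zero (h : SignSymmetric ν Y) {a b c d : Fin N}
    (h0 : ¬(a = b ∧ c = d)) (h1 : ¬(a = c ∧ b = d)) (h2 : ¬(a = d ∧ b = c)) :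
    ∫ x, Y a x * Y b x * Y c x * Y d x ∂ν = 0 := by
  obtain ⟨k, hk⟩ : ∃ k, ∀ u : Fin N → ℝ, (if a = k then -u a else u a) *
      (if b = k then -u b else u b) * (if c = k then -u c else u c) *
      (if d = k then -u d else u d) = -(u a * u b * u c * u d) := by
    by_cases hab : a = b
    · subst hab
      refine ⟨c, fun u => ?_⟩
      have : d ≠ c := fun h => h0 ⟨rfl, h.symm⟩
      by_cases hac : a = c <;> simp [*]
    · by_cases hac : a = c
      · subst hac
        refine ⟨b, fun u => ?_⟩
        have : d ≠ b := fun h => h1 ⟨rfl, h.symm⟩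
        simp [*]
      · by_cases had : a = d
        · subst had
          refine ⟨b, fun u => ?_⟩
          have : c ≠ b := fun h => h2 ⟨rfl, h.symm⟩
          simp [*]
        · refine ⟨a, fun u => ?_⟩
          simp [Ne.symm hab, Ne.symm hac, Ne.symm had]
  obtain ⟨φ, ε, hφ, hε, hY⟩ := h k
  refine hφ.integral_eq_zero_of_comp_eq_neg fun x => ?_
  simp only [hY]
  linear_combination ε ^ 4 * hk (fun i => Y i x) -
    (Y a x * Y b x * Y c x * Y d x) * (ε ^ 2 + 1) * hε

theorem SignSymmetric.abs_integral_mul_mul_mul_le (h : SignSymmetric ν Y) {s : ℝ} {m : ℕ}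
    (hm : 3 ≤ m) (hsq : ∀ a b, a ≠ b → ∫ x, Y a x ^ 2 * Y b x ^ 2 ∂ν ≤ s ^ 2)
    (hfour : ∀ a, ∫ x, Y a x ^ 4 ∂ν ≤ s ^ 2 * m) (a b c d : Fin N) :
    |∫ x, Y a x * Y b x * Y c x * Y d x ∂ν| ≤
      s ^ 2 * ∑ j : Fin m, if PairedBy j a b c d then 1 else 0 := by
  have hsum : ∀ j : Fin m, PairedBy j a b c d →
      s ^ 2 ≤ s ^ 2 * ∑ j : Fin m, if PairedBy j a b c d then (1 : ℝ) else 0 := fun j hj => by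
    refine le_mul_of_one_le_right (sq_nonneg s) ?_
    have := Finset.single_le_sum (f := fun j : Fin m => if PairedBy j a b c d then (1 : ℝ) else 0)
      (fun j _ => by positivity) (Finset.mem_univ j)
    simpa [hj] using this
  have hpair : ∀ a' b', (∀ x, Y a x * Y b x * Y c x * Y d x = Y a' x ^ 2 * Y b' x ^ 2) →
      a' ≠ b' → |∫ x, Y a x * Y b x * Y c x * Y d x ∂ν| ≤ s ^ 2 := fun a' b' he hne => by
    simp only [he]
    rw [abs_of_nonneg (integral_nonneg fun x => by positivity)]
    exact hsq a' b' hne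
  by_cases hall : a = b ∧ a = c ∧ a = d
  · obtain ⟨rfl, rfl, rfl⟩ := hall
    have hp : ∀ j : ℕ, PairedBy j a a a a
      | 0 => by simp [PairedBy]
      | 1 => by simp [PairedBy]
      | 2 => by simp [PairedBy]
      | _ + 3 => by simp [PairedBy]
    have he : ∀ x, Y a x * Y a x * Y a x * Y a x = Y a x ^ 4 := fun x => by ring
    simp only [hp, he, if_true, Finset.sum_const, Finset.card_univ, Fintype.card_fin, nsmul_eq_mul,
      mul_one]
    rw [abs_of_nonneg (integral_nonneg fun x => by positivity)]
    exact hfour a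
  by_cases h0 : a = b ∧ c = d
  · refine (hpair a c (fun x => ?_) ?_).trans (hsum ⟨0, by omega⟩ h0)
    · rw [← h0.1, ← h0.2]; ring
    · rintro rfl; exact hall ⟨h0.1, rfl, h0.2⟩
  by_cases h1 : a = c ∧ b = d
  · refine (hpair a b (fun x => ?_) ?_).trans (hsum ⟨1, by omega⟩ h1)
    · rw [← h1.1, ← h1.2]; ring
    · rintro rfl; exact hall ⟨rfl, h1.1, h1.2⟩
  by_cases h2 : a = d ∧ b = c
  · refine (hpair a b (fun x => ?_) ?_).trans (hsum ⟨2, by omega⟩ h2)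
    · rw [← h2.1, ← h2.2]; ring
    · rintro rfl; exact hall ⟨rfl, h2.2, h2.1⟩
  rw [h.integral_mul_mul_mul_eq_zero h0 h1 h2, abs_zero]
  positivity

end SignSymmetry

section DeterminantMomentBounds

variable {Ω : Type*} [MeasurableSpace Ω] {ν : Measure Ω} [IsProbabilityMeasure ν] {N : ℕ}
  {Y : Fin N → Ω → ℝ}

theorem ascFactorial_le_factorial_mul_pow {m : ℕ} (hm : 0 < m) (N : ℕ) :
    m.ascFactorial N ≤ N.factorial * (N + m) ^ m := by
  rw [Nat.ascFactorial_eq_factorial_mul_choose']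
  gcongr
  rw [Nat.choose_symm_of_eq_add (b := m - 1) (by omega)]
  calc _ ≤ (m + N - 1) ^ (m - 1) := Nat.choose_le_pow _ _
    _ ≤ (N + m) ^ (m - 1) := by gcongr; omega
    _ ≤ _ := Nat.pow_le_pow_right (by omega) (by omega)

theorem SignSymmetric.det_moment_bounds (h : SignSymmetric ν Y) (hmeas : ∀ a, Measurable (Y a))
    {B : ℝ} (hB : ∀ a, ∀ᵐ x ∂ν, |Y a x| ≤ B) {s : ℝ} (hs : 0 < s) {m : ℕ} (hm : 3 ≤ m)
    (hvar : ∀ a, ∫ x, Y a x ^ 2 ∂ν = s)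
    (hsq : ∀ a b, a ≠ b → ∫ x, Y a x ^ 2 * Y b x ^ 2 ∂ν ≤ s ^ 2)
    (hfour : ∀ a, ∫ x, Y a x ^ 4 ∂ν ≤ s ^ 2 * m) {κ : ℝ} (hκ : κ ≠ 0) {p : ℝ} (hp1 : 1 ≤ p)
    (hp4 : p ≤ 4) :
    (κ ^ 2 * (N.factorial * s ^ N)) ^ (p / 2) / (128 * ((N : ℝ) + m) ^ m) ≤
        ∫ x : Fin N → Ω, |κ * (Matrix.of fun b i => Y b (x i)).det| ^ p ∂Measure.pi (fun _ => ν) ∧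
      ∫ x : Fin N → Ω, |κ * (Matrix.of fun b i => Y b (x i)).det| ^ p ∂Measure.pi (fun _ => ν) ≤
        (κ ^ 2 * (N.factorial * s ^ N)) ^ (p / 2) * (1 + ((N : ℝ) + m) ^ m) := by
  have hbdd : ∀ {f : Ω → ℝ} {K : ℝ}, Measurable f → (∀ᵐ x ∂ν, |f x| ≤ K) → Integrable f ν :=
    fun hf hK => Integrable.of_bound hf.aestronglyMeasurable _ hK
  have hInt2 : ∀ a b, Integrable (fun x => Y a x * Y b x) ν := fun a b => by
    refine hbdd (K := B * B) ((hmeas a).mul (hmeas b)) ?_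
    filter_upwards [hB a, hB b] with x ha hb
    rw [abs_mul]
    exact mul_le_mul ha hb (abs_nonneg _) ((abs_nonneg _).trans ha)
  have hInt4 : ∀ a b c d, Integrable (fun x => Y a x * Y b x * Y c x * Y d x) ν :=
    fun a b c d => by
      refine hbdd (K := B * B * B * B) ((((hmeas a).mul (hmeas b)).mul (hmeas c)).mul (hmeas d)) ?_
      filter_upwards [hB a, hB b, hB c, hB d] with x ha hb hc hd
      have hB0 : 0 ≤ B := (abs_nonneg _).trans ha
      simp only [abs_mul]
      gcongr
  have hcov : ∀ a b, ∫ x, Y a x * Y b x ∂ν = if a = b then s else 0 := fun a b => by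
    split_ifs with hab
    · subst hab
      rw [← hvar a]
      simp only [sq]
    · exact h.integral_mul_eq_zero hab
  have hdet : Measurable fun x : Fin N → Ω => (Matrix.of fun b i => Y b (x i)).det := by
    simp only [Matrix.det_apply, Matrix.of_apply]
    refine Finset.measurable_sum _ fun σ _ => Measurable.const_smul ?_ _
    exact Finset.measurable_prod _ fun i _ => (hmeas _).comp (measurable_pi_apply _)
  refine rpow_moment_bounds hp1 hp4 (hdet.const_mul κ).aestronglyMeasurable ?_ (by positivity)
    (by positivity) ?_ ?_
  · simp only [mul_pow]
    exact (integrable_det_pow_four hInt4).const_mul _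
  · simp only [mul_pow]
    rw [integral_const_mul, integral_det_sq hInt2 hcov]
  · simp only [mul_pow]
    rw [integral_const_mul]
    have hle := integral_det_pow_four_le hInt4 (h.abs_integral_mul_mul_mul_le hm hsq hfour)
    have hasc : (m.ascFactorial N : ℝ) ≤ N.factorial * ((N : ℝ) + m) ^ m := by
      exact_mod_cast ascFactorial_le_factorial_mul_pow (by omega) N
    calc _ ≤ κ ^ 4 * (N.factorial * (N.factorial * ((N : ℝ) + m) ^ m) * s ^ (2 * N)) := by
          gcongr
          exact hle.trans (by gcongr)
      _ = _ := by ring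

end DeterminantMomentBounds

section RandomPolytopes

variable {n : ℕ} {q p : ℝ}

theorem measurePreserving_unifMeasure {K : Set (EuclideanSpace ℝ (Fin n))} (hK : MeasurableSet K)
    (e : EuclideanSpace ℝ (Fin n) ≃ₗᵢ[ℝ] EuclideanSpace ℝ (Fin n)) (he : e ⁻¹' K = K) :
    MeasurePreserving e.toMeasurableEquiv (unifMeasure n K) (unifMeasure n K) := by
  have h := e.measurePreserving.restrict_preimage hK
  rw [he] at h
  exact h.smul_measure _

/-- The reflection changing the sign of one coordinate. -/
noncomputable def coordReflection (a : Fin n) :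
    EuclideanSpace ℝ (Fin n) ≃ₗᵢ[ℝ] EuclideanSpace ℝ (Fin n) :=
  LinearIsometryEquiv.piLpCongrRight 2 fun i =>
    if i = a then LinearIsometryEquiv.neg ℝ else LinearIsometryEquiv.refl ℝ ℝ

theorem coordReflection_apply (a b : Fin n) (x : EuclideanSpace ℝ (Fin n)) :
    coordReflection a x b = if b = a then -x b else x b := by
  simp only [coordReflection, LinearIsometryEquiv.piLpCongrRight_apply]
  split_ifs <;> simp

theorem measurePreserving_coordReflection (a : Fin n) :
    MeasurePreserving (coordReflection a).toMeasurableEquiv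
      (unifMeasure n (lqBall n q)) (unifMeasure n (lqBall n q)) := by
  refine measurePreserving_unifMeasure measurableSet_lqBall _ (Set.ext fun x => ?_)
  have h : ∀ b, |coordReflection a x b| = |x b| := fun b => by
    rw [coordReflection_apply]; split_ifs <;> simp
  simp only [lqBall, Set.mem_preimage, Set.mem_ofPred_eq, h]

theorem signSymmetric_coord : SignSymmetric (unifMeasure n (lqBall n q))
    fun (b : Fin n) (x : EuclideanSpace ℝ (Fin n)) => x b := fun a =>
  ⟨(coordReflection a).toMeasurableEquiv, 1, measurePreserving_coordReflection a, one_pow 2,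
    fun b x => by rw [one_mul]; exact coordReflection_apply a b x⟩

/-- The coordinates of a point, preceded by a constant. -/
def affineCoord (r : ℝ) (b : Fin (n + 1)) (x : EuclideanSpace ℝ (Fin n)) : ℝ :=
  (Fin.cons r (x : Fin n → ℝ) : Fin (n + 1) → ℝ) b

theorem measurable_affineCoord (r : ℝ) (b : Fin (n + 1)) :
    Measurable (affineCoord (n := n) r b) := by
  change Measurable fun x => affineCoord r b x
  refine Fin.cases ?_ (fun b => ?_) b
  · simp only [affineCoord, Fin.cons_zero]
    fun_prop
  · simp only [affineCoord, Fin.cons_succ]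
    fun_prop

theorem signSymmetric_affineCoord (r : ℝ) :
    SignSymmetric (unifMeasure n (lqBall n q)) (affineCoord r) := by
  intro a
  refine Fin.cases ?_ (fun a => ?_) a
  · refine ⟨(LinearIsometryEquiv.neg ℝ).toMeasurableEquiv, -1,
      measurePreserving_unifMeasure measurableSet_lqBall _ (Set.ext fun x => ?_), by norm_num,
      fun b x => ?_⟩
    · simp [lqBall]
    · refine Fin.cases ?_ (fun b => ?_) b <;> simp [affineCoord]
  · refine ⟨(coordReflection a).toMeasurableEquiv, 1, measurePreserving_coordReflection a,
      one_pow 2, fun b x => ?_⟩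
    refine Fin.cases ?_ (fun b => ?_) b
    · simp [affineCoord, (Fin.succ_ne_zero a).symm]
    · simpa [affineCoord] using coordReflection_apply a b x

theorem det_affineCoord (r : ℝ) (x : Fin (n + 1) → EuclideanSpace ℝ (Fin n)) :
    (Matrix.of fun b i => affineCoord r b (x i)).det =
      r * (Matrix.of fun b i => affineCoord 1 b (x i)).det := by
  have h : (Matrix.of fun b i => affineCoord r b (x i)) =
      (Matrix.of fun b i => affineCoord 1 b (x i)).updateRow 0
        (r • (Matrix.of fun b i => affineCoord 1 b (x i)) 0) := by
    ext b i
    refine Fin.cases ?_ (fun b => ?_) b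
    · simp [affineCoord]
    · simp [affineCoord]
  rw [h, Matrix.det_updateRow_smul, Matrix.updateRow_eq_self]

/-- An integer bound, at least `3`, for the kurtosis of the coordinates. -/
noncomputable def kurtosisBound (q : ℝ) : ℕ := ⌈lqKurtosis (1 / q)⌉₊ + 3

theorem three_le_kurtosisBound : 3 ≤ kurtosisBound q := by simp [kurtosisBound]

theorem integral_coord_pow_four_le (hq : 0 < q) (a : Fin n) :
    ∫ x, x a ^ 4 ∂unifMeasure n (lqBall n q) ≤ lqVariance n (1 / q) ^ 2 * kurtosisBound q := by
  refine (integral_unifMeasure_lqBall_pow_four_le hq a).trans ?_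
  gcongr
  rw [kurtosisBound]
  push_cast
  linarith [Nat.le_ceil (lqKurtosis (1 / q))]

theorem crossVol_moment_bounds (hq : 0 < q) (hp1 : 1 ≤ p) (hp4 : p ≤ 4) (hn : n ≠ 0) :
    (4 ^ n * lqSimplexSecondMoment n (1 / q)) ^ (p / 2) /
        (128 * ((n : ℝ) + kurtosisBound q) ^ kurtosisBound q) ≤
        ∫ x, |randCrossVol n (lqBall n q) x| ^ p ∂jointUnif n n (lqBall n q) ∧
      ∫ x, |randCrossVol n (lqBall n q) x| ^ p ∂jointUnif n n (lqBall n q) ≤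
        (4 ^ n * lqSimplexSecondMoment n (1 / q)) ^ (p / 2) *
          (1 + ((n : ℝ) + kurtosisBound q) ^ kurtosisBound q) := by
  have := isProbabilityMeasure_unifMeasure_lqBall (n := n) hq
  have hv := lqVolume_pos (one_div_pos.2 hq) n
  have h := (signSymmetric_coord (n := n) (q := q)).det_moment_bounds (B := 1)
    (fun a => by fun_prop) (ae_abs_le_one_unifMeasure_lqBall hq) (lqVariance_pos (one_div_pos.2 hq) n)
    three_le_kurtosisBound (integral_unifMeasure_lqBall_sq hq)
    (fun a b hab => integral_unifMeasure_lqBall_sq_mul_sq_le hq hab)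
    (integral_coord_pow_four_le hq)
    (κ := 2 ^ n / n.factorial / lqVolume n (1 / q)) (by positivity) hp1 hp4
  have hZ : ∀ x : Fin n → EuclideanSpace ℝ (Fin n), |randCrossVol n (lqBall n q) x| =
      |2 ^ n / n.factorial / lqVolume n (1 / q) * (Matrix.of fun b i => x i b).det| := fun x => by
    rw [randCrossVol, volume_convexHull_range_union_neg hn, volume_lqBall hq,
      ENNReal.toReal_ofReal hv.le, mul_div_right_comm, abs_mul, abs_mul, abs_abs]
  have hA : (2 ^ n / n.factorial / lqVolume n (1 / q)) ^ 2 *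
      (n.factorial * lqVariance n (1 / q) ^ n) = 4 ^ n * lqSimplexSecondMoment n (1 / q) := by
    rw [lqSimplexSecondMoment, show (4 : ℝ) ^ n = (2 ^ n) ^ 2 by rw [pow_right_comm]; norm_num]
    field_simp
  simp only [hZ, jointUnif]
  rw [hA] at h
  exact h

theorem simplexVol_moment_bounds (hq : 0 < q) (hp1 : 1 ≤ p) (hp4 : p ≤ 4) :
    ((n + 1) * lqSimplexSecondMoment n (1 / q)) ^ (p / 2) /
        (128 * ((n : ℝ) + (1 + kurtosisBound q)) ^ kurtosisBound q) ≤
        ∫ x, |randSimplexVol n (lqBall n q) x| ^ p ∂jointUnif n (n + 1) (lqBall n q) ∧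
      ∫ x, |randSimplexVol n (lqBall n q) x| ^ p ∂jointUnif n (n + 1) (lqBall n q) ≤
        ((n + 1) * lqSimplexSecondMoment n (1 / q)) ^ (p / 2) *
          (1 + ((n : ℝ) + (1 + kurtosisBound q)) ^ kurtosisBound q) := by
  have := isProbabilityMeasure_unifMeasure_lqBall (n := n) hq
  have hv := lqVolume_pos (one_div_pos.2 hq) n
  have hs := lqVariance_pos (one_div_pos.2 hq) n
  set s := lqVariance n (1 / q) with hs_def
  have hr : √s ^ 2 = s := Real.sq_sqrt hs.le
  have hr4 : √s ^ 4 = s ^ 2 := by rw [show √s ^ 4 = (√s ^ 2) ^ 2 by ring, hr]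
  have hr0 : 0 < √s := Real.sqrt_pos.2 hs
  have hB : ∀ a, ∀ᵐ x ∂unifMeasure n (lqBall n q), |affineCoord √s a x| ≤ 1 + √s := fun a => by
    refine Fin.cases ?_ (fun a => ?_) a
    · exact ae_of_all _ fun x => by simp [affineCoord, abs_of_pos hr0]
    · filter_upwards [ae_abs_le_one_unifMeasure_lqBall hq a] with x hx
      simp only [affineCoord, Fin.cons_succ]
      linarith
  have hvar : ∀ a, ∫ x, affineCoord √s a x ^ 2 ∂unifMeasure n (lqBall n q) = s := fun a => by
    refine Fin.cases ?_ (fun a => ?_) a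
    · simp [affineCoord, hr]
    · simpa only [affineCoord, Fin.cons_succ] using integral_unifMeasure_lqBall_sq hq a
  have hsq : ∀ a b, a ≠ b →
      ∫ x, affineCoord √s a x ^ 2 * affineCoord √s b x ^ 2 ∂unifMeasure n (lqBall n q) ≤ s ^ 2 := by
    intro a b
    refine Fin.cases ?_ (fun a => ?_) a <;> refine Fin.cases ?_ (fun b => ?_) b <;> intro hab
    · exact absurd rfl hab
    · simp only [affineCoord, Fin.cons_succ, Fin.cons_zero]
      rw [integral_const_mul, integral_unifMeasure_lqBall_sq hq, hr, ← hs_def, sq]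
    · simp only [affineCoord, Fin.cons_succ, Fin.cons_zero]
      rw [integral_mul_const, integral_unifMeasure_lqBall_sq hq, hr, ← hs_def, sq]
    · exact integral_unifMeasure_lqBall_sq_mul_sq_le hq fun h => hab (congrArg _ h)
  have hfour : ∀ a, ∫ x, affineCoord √s a x ^ 4 ∂unifMeasure n (lqBall n q) ≤
      s ^ 2 * kurtosisBound q := fun a => by
    refine Fin.cases ?_ (fun a => ?_) a
    · have : (1 : ℝ) ≤ kurtosisBound q := by
        exact_mod_cast le_trans (by norm_num) (three_le_kurtosisBound (q := q))
      simpa [affineCoord, hr4] using le_mul_of_one_le_right (sq_nonneg s) this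
    · exact integral_coord_pow_four_le hq a
  have h := (signSymmetric_affineCoord (q := q) √s).det_moment_bounds (measurable_affineCoord √s) hB hs
    three_le_kurtosisBound hvar hsq hfour
    (κ := 1 / n.factorial / lqVolume n (1 / q) / √s) (by positivity) hp1 hp4
  have hZ : ∀ x : Fin (n + 1) → EuclideanSpace ℝ (Fin n), |randSimplexVol n (lqBall n q) x| =
      |1 / n.factorial / lqVolume n (1 / q) / √s *
        (Matrix.of fun b i => affineCoord √s b (x i)).det| := fun x => by
    rw [det_affineCoord, ← mul_assoc, div_mul_cancel₀ _ hr0.ne', randSimplexVol,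
      volume_convexHull_range, volume_lqBall hq, ENNReal.toReal_ofReal hv.le,
      mul_div_right_comm, abs_mul, abs_mul, abs_abs]
    rfl
  have hA : (1 / n.factorial / lqVolume n (1 / q) / √s) ^ 2 *
      ((n + 1).factorial * s ^ (n + 1)) = (n + 1) * lqSimplexSecondMoment n (1 / q) := by
    rw [div_pow, hr, lqSimplexSecondMoment, ← hs_def, Nat.factorial_succ, pow_succ s]
    push_cast
    field_simp
  simp only [hZ, jointUnif]
  rw [hA] at h
  push_cast at h
  simpa only [add_assoc] using h

end RandomPolytopes

/-- For fixed `1 ≤ q < ∞` and fixed `1 ≤ p ≤ 4`,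
`√n ‖V_{B_qⁿ}‖_p^{1/n} → √(α(1/q))` and `√n ‖U_{B_qⁿ}‖_p^{1/n} → (1/2) √(α(1/q))`
as `n → ∞`. -/
theorem asymptotics_lpNorms_lqBall (q : ℝ) (hq : 1 ≤ q) (p : ℝ) (hp1 : 1 ≤ p)
    (hp4 : p ≤ 4) :
    Tendsto (fun n : ℕ => Real.sqrt n * lpNormVlq n q p ^ ((n : ℝ)⁻¹)) atTop
        (nhds (Real.sqrt (alphaFn (1 / q)))) ∧
      Tendsto (fun n : ℕ => Real.sqrt n * lpNormUlq n q p ^ ((n : ℝ)⁻¹)) atTop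
        (nhds ((1 / 2) * Real.sqrt (alphaFn (1 / q)))) := by
  have hq0 : 0 < q := by linarith
  have ht : 0 < 1 / q := one_div_pos.2 hq0
  have hG := lqSimplexSecondMoment_pos ht
  have hlim := tendsto_lqSimplexSecondMoment_rpow_inv ht ((div_le_one hq0).2 hq)
  have hd : (0 : ℝ) < kurtosisBound q := by
    exact_mod_cast lt_of_lt_of_le (by norm_num) (three_le_kurtosisBound (q := q))
  constructor
  · refine tendsto_sqrt_mul_root (by linarith) hd (c := kurtosisBound q)
      (a := fun n => 4 ^ n * lqSimplexSecondMoment n (1 / q))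
      (Eventually.of_forall fun n => mul_pos (by positivity) (hG n)) ?_ ?_ ?_
    · filter_upwards [eventually_ne_atTop 0] with n hn
      exact (crossVol_moment_bounds hq0 hp1 hp4 hn).1
    · filter_upwards [eventually_ne_atTop 0] with n hn
      exact (crossVol_moment_bounds hq0 hp1 hp4 hn).2
    · have h4 := hlim.const_mul 4
      rw [mul_div_cancel₀ _ four_ne_zero] at h4
      refine h4.congr' ?_
      filter_upwards [eventually_ne_atTop 0] with n hn
      rw [Real.mul_rpow (by positivity) (hG n).le, Real.pow_rpow_inv_natCast (by norm_num) hn]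
      ring
  · have hsqrt : 1 / 2 * √(alphaFn (1 / q)) = √(alphaFn (1 / q) / 4) := by
      rw [Real.sqrt_div' _ (by norm_num), show (4 : ℝ) = 2 ^ 2 by norm_num,
        Real.sqrt_sq (by norm_num)]
      ring
    rw [hsqrt]
    refine tendsto_sqrt_mul_root (by linarith) (by linarith : (0 : ℝ) < 1 + kurtosisBound q)
      (c := kurtosisBound q)
      (a := fun n => (n + 1) * lqSimplexSecondMoment n (1 / q))
      (Eventually.of_forall fun n => mul_pos (by positivity) (hG n))
      (Eventually.of_forall fun n => (simplexVol_moment_bounds hq0 hp1 hp4).1)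
      (Eventually.of_forall fun n => (simplexVol_moment_bounds hq0 hp1 hp4).2) ?_
    have h1 := (tendsto_const_mul_pow_rpow_inv one_pos 1 1).mul hlim
    rw [one_mul] at h1
    refine h1.congr fun n => ?_
    rw [one_mul, pow_one, Real.mul_rpow (by positivity) (hG n).le]
    ring
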